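/- arXiv:1101.2075 — 2 statements merged into one kernel-verified Lean document; each statement's English description precedes it below -/
import Mathlib

section
/- Let c = c_n be the n-cycle s_{n−1}⋯s_2s_1, ζ = e^{2πi/n}, and f⁺ = (1/n) ∑_{k=0}^{n−1} ζ^{−k} c^{−k} ∈ ℂW. Then e_n f⁺ = (1/n) · e_n (1 − ζc_1)(1 − ζc_2)⋯(1 − ζc_{n−1}), and the idempotent f⁺ acts invertibly by right multiplication on e_n: there exists y ∈ ℂW with e_n f⁺ y = e_n. In particular e_n f⁺ ≠ 0 and e_n f⁺ ℂW = e_n ℂW. -/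
open scoped Classical
open MonoidAlgebra Finset Equiv

noncomputable section

namespace DPRSym

variable (n : ℕ)

/-- The simple reflection `s_i` (1-based, `1 ≤ i ≤ n-1`) of the symmetric group
`S_n = Perm (Fin n)`: the transposition of the (0-based) points `i-1` and `i`. -/
def sgen (i : ℕ) : Equiv.Perm (Fin n) :=
  if h : 0 < i ∧ i < n then Equiv.swap ⟨i - 1, by omega⟩ ⟨i, h.2⟩ else 1

/-- The Coxeter generating set `S = {s_1, …, s_{n-1}}` of `S_n`. -/
def Simples : Finset (Equiv.Perm (Fin n)) := (Finset.Icc 1 (n - 1)).image (sgen n)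

/-- The Coxeter length of a permutation: the length of a shortest word in the
generators `S` expressing it. -/
def len (w : Equiv.Perm (Fin n)) : ℕ :=
  sInf {k | ∃ L : List (Equiv.Perm (Fin n)),
    (∀ x ∈ L, x ∈ Simples n) ∧ L.length = k ∧ L.prod = w}

/-- The `i`-cycle `c_i = s_{i-1} ⋯ s_2 s_1` (with `c_1 = 1`). -/
def cgen (i : ℕ) : Equiv.Perm (Fin n) :=
  (((List.range (i - 1)).reverse).map (fun j => sgen n (j + 1))).prod

/-- The set `W^I` of minimal length left coset representatives of `W_I`,
computed inside the subset `H` (take `H = Set.univ` for the absolute case). -/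
def minCoset (H : Set (Equiv.Perm (Fin n))) (I : Finset (Equiv.Perm (Fin n))) :
    Finset (Equiv.Perm (Fin n)) :=
  Finset.univ.filter (fun w => w ∈ H ∧ ∀ s ∈ I, len n w < len n (w * s))

/-- The element `x_I = ∑_{w ∈ W^I} w` of the group algebra. -/
def xRel (H : Set (Equiv.Perm (Fin n))) (I : Finset (Equiv.Perm (Fin n))) :
    MonoidAlgebra ℂ (Equiv.Perm (Fin n)) :=
  ∑ w ∈ minCoset n H I, of ℂ (Equiv.Perm (Fin n)) w

/-- `w(Δ_J) ⊆ Δ_D`: for every `s ∈ J`, `wsw⁻¹ ∈ D` and `ℓ(ws) = ℓ(w) + 1`. -/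
def Takes (D : Finset (Equiv.Perm (Fin n))) (w : Equiv.Perm (Fin n))
    (J : Finset (Equiv.Perm (Fin n))) : Prop :=
  ∀ s ∈ J, w * s * w⁻¹ ∈ D ∧ len n (w * s) = len n w + 1

/-- `ᵂJ = wJw⁻¹`. -/
def conjF (w : Equiv.Perm (Fin n)) (J : Finset (Equiv.Perm (Fin n))) :
    Finset (Equiv.Perm (Fin n)) :=
  J.image (fun s => w * s * w⁻¹)

/-- The coefficient `m_{JK}` (for `σ ≡ 1`: the number of `w ∈ W^K` with
`w(Δ_J) ⊆ Δ`), relative to the pair `(H, D)`. -/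
def mC (H : Set (Equiv.Perm (Fin n))) (D : Finset (Equiv.Perm (Fin n)))
    (J K : Finset (Equiv.Perm (Fin n))) : ℕ :=
  if J ⊆ K then ((minCoset n H K).filter (fun w => Takes n D w J)).card else 0

/-- The family `(e_J)` of BBHT quasi-idempotents for `σ ≡ 1`, relative to `(H, D)`:
the unique solution of the triangular system `x_K = ∑_{J ⊆ K} m_{JK} e_J`, `K ⊆ D`. -/
def IsBBHT (H : Set (Equiv.Perm (Fin n))) (D : Finset (Equiv.Perm (Fin n)))
    (e : Finset (Equiv.Perm (Fin n)) → MonoidAlgebra ℂ (Equiv.Perm (Fin n))) : Prop :=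
  ∀ K ∈ D.powerset, xRel n H K = ∑ J ∈ K.powerset, (mC n H D J K : ℂ) • e J

/-- `b⁺(m, k)`: the coefficient of `t^k` in `(1 - c_1 t)(1 - c_2 t) ⋯ (1 - c_m t)`,
a polynomial with coefficients in the group algebra `ℂ S_n`. -/
def bplus (m k : ℕ) : MonoidAlgebra ℂ (Equiv.Perm (Fin n)) :=
  (((List.range m).map (fun i =>
      1 - Polynomial.C (of ℂ (Equiv.Perm (Fin n)) (cgen n (i + 1))) * Polynomial.X)).prod).coeff k

/-- The transposition of the 0-based points `a` and `b` (junk value `1` if out of range). -/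
def fswap (a b : ℕ) : Equiv.Perm (Fin n) :=
  if h : a < n ∧ b < n then Equiv.swap ⟨a, h.1⟩ ⟨b, h.2⟩ else 1

section Length

variable {m : ℕ}

lemma sgen_succ (i : Fin m) : sgen (m + 1) (i + 1) = swap i.castSucc i.succ := by
  have h : 0 < (i : ℕ) + 1 ∧ (i : ℕ) + 1 < m + 1 := by omega
  rw [sgen, dif_pos h]
  rfl

lemma mem_simples {s : Perm (Fin (m + 1))} :
    s ∈ Simples (m + 1) ↔ ∃ i : Fin m, s = swap i.castSucc i.succ := by
  simp only [Simples, mem_image, mem_Icc]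
  constructor
  · rintro ⟨j, hj, rfl⟩
    refine ⟨⟨j - 1, by omega⟩, ?_⟩
    rw [← sgen_succ]
    congr 1
    simp only
    omega
  · rintro ⟨i, rfl⟩
    exact ⟨i + 1, by omega, sgen_succ i⟩

/-- The set of inversions of a permutation. -/
def inversions (w : Perm (Fin m)) : Finset (Fin m × Fin m) :=
  univ.filter fun p => p.1 < p.2 ∧ w p.2 < w p.1

lemma mem_inversions {w : Perm (Fin m)} {a b : Fin m} :
    (a, b) ∈ inversions w ↔ a < b ∧ w b < w a := by
  simp [inversions]

lemma swap_lt_swap {i : Fin m} {a b : Fin (m + 1)} (hab : a < b)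
    (h : ¬ (a = i.castSucc ∧ b = i.succ)) :
    swap i.castSucc i.succ a < swap i.castSucc i.succ b := by
  simp only [Equiv.swap_apply_def, Fin.ext_iff, Fin.lt_def, Fin.val_castSucc, Fin.val_succ] at *
  split_ifs <;> (try simp only [Fin.val_castSucc, Fin.val_succ]) <;> omega

lemma inversions_mul_swap {w : Perm (Fin (m + 1))} {i : Fin m} (h : w i.castSucc < w i.succ) :
    inversions (w * swap i.castSucc i.succ) = insert (i.castSucc, i.succ)
      ((inversions w).map ((swap i.castSucc i.succ).prodCongr
        (swap i.castSucc i.succ)).toEmbedding) := by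
  ext ⟨a, b⟩
  simp only [mem_insert, mem_map_equiv, Prod.mk.injEq, Equiv.prodCongr_symm,
    Equiv.prodCongr_apply, Prod.map_apply, Equiv.symm_swap, mem_inversions, Perm.mul_apply]
  constructor
  · rintro ⟨hab, hw⟩
    by_cases hi : a = i.castSucc ∧ b = i.succ
    · exact Or.inl hi
    · exact Or.inr ⟨swap_lt_swap hab hi, hw⟩
  · rintro (⟨rfl, rfl⟩ | ⟨hab, hw⟩)
    · exact ⟨Fin.castSucc_lt_succ, by simpa using h⟩
    · refine ⟨?_, hw⟩
      have := swap_lt_swap (i := i) hab (by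
        rintro ⟨h1, h2⟩
        rw [h1, h2] at hw
        exact lt_asymm h hw)
      simpa using this

lemma card_inversions_mul_swap_of_lt {w : Perm (Fin (m + 1))} {i : Fin m}
    (h : w i.castSucc < w i.succ) :
    (inversions (w * swap i.castSucc i.succ)).card = (inversions w).card + 1 := by
  rw [inversions_mul_swap h, card_insert_of_notMem, card_map]
  simp [mem_map_equiv, inversions, Fin.castSucc_lt_succ.le]

lemma card_inversions_mul_swap_of_gt {w : Perm (Fin (m + 1))} {i : Fin m}
    (h : w i.succ < w i.castSucc) :
    (inversions (w * swap i.castSucc i.succ)).card + 1 = (inversions w).card := by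
  have := card_inversions_mul_swap_of_lt (w := w * swap i.castSucc i.succ) (i := i) (by simpa)
  simpa [mul_assoc] using this.symm

lemma lt_or_gt_castSucc_succ (w : Perm (Fin (m + 1))) (i : Fin m) :
    w i.castSucc < w i.succ ∨ w i.succ < w i.castSucc :=
  lt_or_gt_of_ne fun h => Fin.castSucc_lt_succ.ne (w.injective h)

lemma card_inversions_prod_le (L : List (Perm (Fin (m + 1)))) :
    (∀ x ∈ L, x ∈ Simples (m + 1)) → (inversions L.prod).card ≤ L.length := by
  induction L using List.reverseRecOn with
  | nil =>
    have : inversions (1 : Perm (Fin (m + 1))) = ∅ :=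
      filter_eq_empty_iff.2 fun p _ hp => lt_asymm hp.1 hp.2
    simp [this]
  | append_singleton L s ih =>
    intro h
    obtain ⟨i, rfl⟩ := mem_simples.1 (h s (by simp))
    have := ih fun x hx => h x (by simp [hx])
    rw [List.prod_append, List.prod_singleton, List.length_append, List.length_singleton]
    rcases lt_or_gt_castSucc_succ L.prod i with hi | hi
    · rw [card_inversions_mul_swap_of_lt hi]; omega
    · have := card_inversions_mul_swap_of_gt hi; omega

lemma exists_word (k : ℕ) : ∀ w : Perm (Fin (m + 1)), (inversions w).card = k →
    ∃ L : List (Perm (Fin (m + 1))), (∀ x ∈ L, x ∈ Simples (m + 1)) ∧ L.length = k ∧ L.prod = w := by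
  induction k with
  | zero =>
    intro w hw
    refine ⟨[], by simp, rfl, ?_⟩
    have hmono : Monotone w := by
      intro a b hab
      by_contra! hlt
      have : (a, b) ∈ inversions w := by
        simp only [inversions, mem_filter, mem_univ, true_and]
        exact ⟨hab.lt_of_ne (by rintro rfl; exact lt_irrefl _ hlt), hlt⟩
      simp [card_eq_zero.1 hw] at this
    exact ((Equiv.Perm.monotone_iff w).1 hmono).symm
  | succ k ih =>
    intro w hw
    obtain ⟨i, hi⟩ : ∃ i : Fin m, w i.succ < w i.castSucc := by
      by_contra! hall
      have hmono : Monotone w := Fin.monotone_iff_le_succ.2 hall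
      have : inversions w = ∅ := by
        simp only [inversions, filter_eq_empty_iff]
        rintro ⟨a, b⟩ - ⟨h1, h2⟩
        exact absurd (hmono h1.le) h2.not_ge
      simp [this] at hw
    have := card_inversions_mul_swap_of_gt hi
    obtain ⟨L, hL, hlen, hprod⟩ := ih (w * swap i.castSucc i.succ) (by omega)
    refine ⟨L ++ [swap i.castSucc i.succ], ?_, by simp [hlen], by simp [hprod, mul_assoc]⟩
    intro x hx
    rcases List.mem_append.1 hx with hx | hx
    · exact hL x hx
    · exact mem_simples.2 ⟨i, by simpa using hx⟩

lemma len_eq_card_inversions (w : Perm (Fin (m + 1))) :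
    len (m + 1) w = (inversions w).card := by
  apply le_antisymm
  · exact Nat.sInf_le (exists_word _ w rfl)
  · refine le_csInf ⟨_, exists_word _ w rfl⟩ ?_
    rintro k ⟨L, hL, rfl, rfl⟩
    exact card_inversions_prod_le L hL

lemma len_mul_swap_of_lt {w : Perm (Fin (m + 1))} {i : Fin m} (h : w i.castSucc < w i.succ) :
    len (m + 1) (w * swap i.castSucc i.succ) = len (m + 1) w + 1 := by
  simp only [len_eq_card_inversions, card_inversions_mul_swap_of_lt h]

lemma len_lt_len_mul_swap_iff {w : Perm (Fin (m + 1))} {i : Fin m} :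
    len (m + 1) w < len (m + 1) (w * swap i.castSucc i.succ) ↔ w i.castSucc < w i.succ := by
  rcases lt_or_gt_castSucc_succ w i with h | h
  · simp [len_mul_swap_of_lt h, h]
  · have := card_inversions_mul_swap_of_gt h
    simp only [len_eq_card_inversions, h.not_gt, iff_false]
    omega

/-- The simple reflections indexed by a set of adjacent pairs of positions. -/
def reflSet (I : Finset (Fin m)) : Finset (Perm (Fin (m + 1))) :=
  I.image fun i => swap i.castSucc i.succ

lemma swap_castSucc_succ_injective :
    Function.Injective fun i : Fin m => (swap i.castSucc i.succ : Perm (Fin (m + 1))) := by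
  intro i j h
  have h1 : swap i.castSucc i.succ i.castSucc = swap j.castSucc j.succ i.castSucc :=
    congrArg (fun e : Perm (Fin (m + 1)) => e i.castSucc) h
  simp only [Equiv.swap_apply_def, Fin.ext_iff, Fin.val_castSucc, Fin.val_succ] at h1 ⊢
  split_ifs at h1 <;> simp only [Fin.val_castSucc, Fin.val_succ] at * <;> omega

lemma reflSet_injective : Function.Injective (reflSet (m := m)) :=
  image_injective swap_castSucc_succ_injective

lemma reflSet_subset {I K : Finset (Fin m)} : reflSet I ⊆ reflSet K ↔ I ⊆ K :=
  image_subset_image_iff swap_castSucc_succ_injective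

lemma reflSet_univ : reflSet (univ : Finset (Fin m)) = Simples (m + 1) := by
  ext s
  simp [reflSet, mem_simples, eq_comm]

lemma powerset_reflSet (K : Finset (Fin m)) :
    (reflSet K).powerset = K.powerset.image reflSet := by
  ext s
  simp only [mem_powerset, mem_image]
  constructor
  · intro h
    obtain ⟨I, hI, rfl⟩ := subset_image_iff.1 h
    exact ⟨I, hI, rfl⟩
  · rintro ⟨I, hI, rfl⟩
    exact reflSet_subset.2 hI

lemma mem_minCoset_reflSet {K : Finset (Fin m)} {w : Perm (Fin (m + 1))} :
    w ∈ minCoset (m + 1) Set.univ (reflSet K) ↔ ∀ i ∈ K, w i.castSucc < w i.succ := by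
  simp [minCoset, reflSet, len_lt_len_mul_swap_iff]

lemma takes_reflSet {J : Finset (Fin m)} {w : Perm (Fin (m + 1))} :
    Takes (m + 1) (Simples (m + 1)) w (reflSet J) ↔
      ∀ i ∈ J, (w i.succ : ℕ) = w i.castSucc + 1 := by
  simp only [Takes, reflSet, mem_image, forall_exists_index, and_imp, forall_apply_eq_imp_iff₂]
  refine forall₂_congr fun i _ => ?_
  have hconj : w * swap i.castSucc i.succ * w⁻¹ = swap (w i.castSucc) (w i.succ) := by
    rw [Equiv.mul_swap_eq_swap_mul, mul_assoc, mul_inv_cancel, mul_one]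
  rw [hconj]
  constructor
  · rintro ⟨h, hlen⟩
    have hlt : w i.castSucc < w i.succ := len_lt_len_mul_swap_iff.1 (by omega)
    obtain ⟨j, hj⟩ := mem_simples.1 h
    have h1 := congrArg (fun e : Perm (Fin (m + 1)) => e (w i.castSucc)) hj
    simp only [Equiv.swap_apply_left, Equiv.swap_apply_def, Fin.ext_iff] at h1
    rw [Fin.lt_def] at hlt
    split_ifs at h1 <;> simp only [Fin.val_castSucc, Fin.val_succ] at * <;> omega
  · intro h
    have hlt : w i.castSucc < w i.succ := by rw [Fin.lt_def]; omega
    refine ⟨mem_simples.2 ⟨⟨w i.castSucc, by omega⟩, ?_⟩, len_mul_swap_of_lt hlt⟩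
    congr 1
    ext
    simpa using h

end Length

section StableSort

variable {m : ℕ}

lemma inv_apply_apply {α : Type*} (w : Perm α) (x : α) : w⁻¹ (w x) = x :=
  w.symm_apply_apply x

lemma apply_inv_apply {α : Type*} (w : Perm α) (x : α) : w (w⁻¹ x) = x :=
  w.apply_symm_apply x

lemma sort_inv_lt_iff {α : Type*} [LinearOrder α] (f : Fin m → α) (p q : Fin m) :
    (Tuple.sort f)⁻¹ p < (Tuple.sort f)⁻¹ q ↔ f p < f q ∨ f p = f q ∧ p < q := by
  obtain ⟨i, rfl⟩ := (Tuple.sort f).surjective p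
  obtain ⟨j, rfl⟩ := (Tuple.sort f).surjective q
  obtain ⟨hm, ht⟩ := Tuple.eq_sort_iff.1 (rfl : Tuple.sort f = Tuple.sort f)
  simp only [inv_apply_apply]
  constructor
  · intro hij
    rcases (hm hij.le).lt_or_eq with h | h
    · exact Or.inl h
    · exact Or.inr ⟨h, ht i j hij h⟩
  · intro h
    by_contra! hji
    rcases hji.lt_or_eq with hlt | rfl
    · rcases h with h | ⟨h, h'⟩
      · exact absurd (hm hlt.le) h.not_ge
      · exact lt_asymm h' (ht j i hlt h.symm)
    · simp at h

lemma eq_sort_inv {α : Type*} [LinearOrder α] {f : Fin m → α} {w : Perm (Fin m)}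
    (h : ∀ p q, f p < f q ∨ f p = f q ∧ p < q → w p < w q) : w = (Tuple.sort f)⁻¹ := by
  rw [← inv_inj, inv_inv, Tuple.eq_sort_iff]
  constructor
  · intro i j hij
    by_contra! hlt
    have := h _ _ (Or.inl hlt)
    simp only [apply_inv_apply] at this
    exact absurd hij this.not_ge
  · intro i j hij he
    by_contra! hle
    rcases hle.lt_or_eq with hlt | heq
    · have := h _ _ (Or.inr ⟨he.symm, hlt⟩)
      simp only [apply_inv_apply] at this
      exact lt_asymm hij this
    · exact hij.ne' (w⁻¹.injective heq)

lemma rel_of_adjacent {α : Type*} [PartialOrder α] {g : Fin (m + 1) → α} (hg : Monotone g)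
    (R : Fin (m + 1) → Fin (m + 1) → Prop) (htrans : ∀ a b c, R a b → R b c → R a c)
    (hstep : ∀ i : Fin m, g i.castSucc = g i.succ → R i.castSucc i.succ) (p q : Fin (m + 1)) :
    p < q → g p = g q → R p q := by
  induction q using Fin.induction with
  | zero => intro h; exact absurd h (Fin.not_lt_zero p)
  | succ i ih =>
    intro hp he
    have hle : p ≤ i.castSucc := Fin.le_castSucc_iff.2 hp
    have h1 : g i.castSucc = g i.succ :=
      le_antisymm (hg Fin.castSucc_lt_succ.le) (he ▸ hg hle)
    rcases hle.lt_or_eq with hlt | rfl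
    · exact htrans _ _ _ (ih hlt (he.trans h1.symm)) (hstep i h1)
    · exact hstep i h1

/-- The adjacent pairs of positions on which a function takes equal values. -/
def levelAdj {α : Type*} (g : Fin (m + 1) → α) : Finset (Fin m) :=
  univ.filter fun i => g i.castSucc = g i.succ

lemma mem_levelAdj {α : Type*} {g : Fin (m + 1) → α} {i : Fin m} :
    i ∈ levelAdj g ↔ g i.castSucc = g i.succ := by
  simp [levelAdj]

lemma lt_of_levelAdj {α : Type*} [PartialOrder α] {g : Fin (m + 1) → α} (hg : Monotone g)
    {w : Perm (Fin (m + 1))} (hw : ∀ i ∈ levelAdj g, w i.castSucc < w i.succ) {p q : Fin (m + 1)}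
    (hpq : p < q) (he : g p = g q) : w p < w q :=
  rel_of_adjacent hg (fun a b => w a < w b) (fun _ _ _ => lt_trans)
    (fun i hi => hw i (mem_levelAdj.2 hi)) p q hpq he

/-- The sum, over all maps from the positions to an `N`-element chain, of their stable
sorting permutations. -/
def sortSum (m N : ℕ) : MonoidAlgebra ℂ (Perm (Fin (m + 1))) :=
  ∑ f : Fin (m + 1) → Fin N, of ℂ _ (Tuple.sort f)

lemma sortSum_eq_sum_xRel (m N : ℕ) :
    sortSum m N = ∑ g : Fin (m + 1) → Fin N with Monotone g,
      xRel (m + 1) Set.univ (reflSet (levelAdj g)) := by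
  simp only [xRel, sortSum]
  rw [sum_sigma']
  refine sum_bij' (fun f _ => ⟨f ∘ Tuple.sort f, Tuple.sort f⟩) (fun x _ => x.1 ∘ ⇑x.2⁻¹)
    ?_ ?_ ?_ ?_ ?_
  · intro f _
    obtain ⟨hm, ht⟩ := Tuple.eq_sort_iff.1 (rfl : Tuple.sort f = Tuple.sort f)
    simp only [mem_sigma, mem_filter, mem_univ, true_and, mem_minCoset_reflSet, mem_levelAdj]
    exact ⟨hm, fun i hi => ht _ _ Fin.castSucc_lt_succ hi⟩
  · simp
  · intro f _
    funext p
    simp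
  · rintro ⟨g, w⟩ hx
    simp only [mem_sigma, mem_filter, mem_univ, true_and, mem_minCoset_reflSet] at hx
    have hsort : w = Tuple.sort (g ∘ ⇑w⁻¹) := by
      rw [Tuple.eq_sort_iff]
      have hcomp : (g ∘ ⇑w⁻¹) ∘ w = g := by funext p; simp
      rw [hcomp]
      refine ⟨hx.1, fun i j hij he => lt_of_levelAdj hx.1 hx.2 hij ?_⟩
      simpa using he
    simp only [← hsort]
    congr 1
    funext p
    simp
  · simp

end StableSort

section Blocks

variable {m : ℕ}

lemma exists_blockMap (J : Finset (Fin m)) : ∃ b : Fin (m + 1) → Fin (m + 1 - J.card),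
    Monotone b ∧ Function.Surjective b ∧ ∀ i : Fin m, b i.castSucc = b i.succ ↔ i ∈ J := by
  have hJ : J.card ≤ m := by simpa using card_le_univ J
  have hcompl : Jᶜ.card = m - J.card := by simp [card_compl]
  set c : Fin (m + 1) → ℕ := fun p => (Jᶜ.filter fun i => i.castSucc < p).card with hc
  have hcle (p) : c p ≤ m - J.card := hcompl ▸ card_filter_le _ _
  have hstep (i : Fin m) : c i.succ = c i.castSucc + if i ∈ J then 0 else 1 := by
    have : (Jᶜ.filter fun k => k.castSucc < i.succ) =
        (Jᶜ.filter fun k => k.castSucc < i.castSucc) ∪ (Jᶜ.filter fun k => k = i) := by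
      ext k
      simp only [mem_filter, mem_union, Fin.castSucc_lt_succ_iff, Fin.castSucc_lt_castSucc_iff,
        le_iff_lt_or_eq]
      tauto
    simp only [hc]
    rw [this, card_union_of_disjoint]
    · congr 1
      split_ifs with h
      · rw [card_eq_zero, filter_eq_empty_iff]
        rintro k hk rfl
        exact (mem_compl.1 hk) h
      · rw [card_eq_one]
        refine ⟨i, ?_⟩
        ext k
        simp only [mem_filter, mem_compl, mem_singleton]
        constructor
        · exact And.right
        · rintro rfl
          exact ⟨h, rfl⟩
    · rw [disjoint_left]
      intro k hk hk'
      simp only [mem_filter] at hk hk'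
      simp [hk'.2] at hk
  have hmono : Monotone c := Fin.monotone_iff_le_succ.2 fun i => by rw [hstep]; omega
  have hlast : c (Fin.last m) = m - J.card := by
    rw [← hcompl]
    simp only [hc]
    congr 1
    exact filter_true_of_mem fun i _ => Fin.castSucc_lt_last i
  have hzero : c 0 = 0 := by simp [hc]
  have hivt (p : Fin (m + 1)) : ∀ v ≤ c p, ∃ q, c q = v := by
    induction p using Fin.induction with
    | zero => intro v hv; exact ⟨0, by omega⟩
    | succ i ih =>
      intro v hv
      by_cases h : v ≤ c i.castSucc
      · exact ih v h
      · refine ⟨i.succ, ?_⟩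
        have := hstep i
        split_ifs at this <;> omega
  refine ⟨fun p => ⟨c p, by have := hcle p; omega⟩, fun p q h => hmono h, fun v => ?_, fun i => ?_⟩
  · obtain ⟨q, hq⟩ := hivt (Fin.last m) v (by omega)
    exact ⟨q, Fin.ext hq⟩
  · rw [Fin.mk.injEq, hstep]
    split_ifs with h <;> simp [h]

variable {r : ℕ} {b : Fin (m + 1) → Fin r} {w : Perm (Fin (m + 1))}

lemma block_left_lt (hb : Monotone b)
    (hw : ∀ i : Fin m, b i.castSucc = b i.succ → (w i.succ : ℕ) = w i.castSucc + 1)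
    {p p' q : Fin (m + 1)} (hp : b p = b p') (hq : b p ≠ b q) : w p < w q ↔ w p' < w q := by
  have key := rel_of_adjacent hb
    (fun x y => b x = b y ∧ (b x ≠ b q → (w x < w q ↔ w y < w q)))
    (fun x y z hxy hyz => ⟨hxy.1.trans hyz.1, fun h => (hxy.2 h).trans (hyz.2 (hxy.1 ▸ h))⟩)
    (fun i hi => ⟨hi, fun h => by
      have h1 := hw i hi
      have h2 : w q ≠ w i.succ := fun h3 => h (hi.trans (congrArg b (w.injective h3)).symm)
      rw [Ne, Fin.ext_iff] at h2
      simp only [Fin.lt_def]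
      omega⟩)
  rcases lt_trichotomy p p' with h | rfl | h
  · exact (key p p' h hp).2 hq
  · rfl
  · exact ((key p' p h hp.symm).2 (hp ▸ hq)).symm

lemma block_lt (hb : Monotone b)
    (hw : ∀ i : Fin m, b i.castSucc = b i.succ → (w i.succ : ℕ) = w i.castSucc + 1)
    {p p' q q' : Fin (m + 1)} (hp : b p = b p') (hq : b q = b q') (hpq : b p ≠ b q)
    (h : w p < w q) : w p' < w q' := by
  have h1 : w p' < w q := (block_left_lt hb hw hp hpq).1 h
  have h2 : ¬ w q' < w p' := fun h3 =>
    h1.not_gt ((block_left_lt hb hw hq (hp ▸ hpq.symm)).2 h3)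
  exact (not_lt.1 h2).lt_of_ne fun h3 => hpq (hp.trans ((congrArg b (w.injective h3)).trans hq.symm))

/-- Pairs of a monotone map, constant on the blocks of `J`, and a permutation
that is increasing on its level sets and translates every block of `J`. -/
def blockPairs (N : ℕ) (J : Finset (Fin m)) :
    Finset ((Fin (m + 1) → Fin N) × Perm (Fin (m + 1))) :=
  univ.filter fun x => Monotone x.1 ∧ J ⊆ levelAdj x.1 ∧
    (∀ i ∈ levelAdj x.1, x.2 i.castSucc < x.2 i.succ) ∧
    ∀ i ∈ J, (x.2 i.succ : ℕ) = x.2 i.castSucc + 1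

lemma card_blockPairs (N : ℕ) (J : Finset (Fin m)) :
    (blockPairs N J).card = N ^ (m + 1 - J.card) := by
  obtain ⟨b, hb, hsurj, hbJ⟩ := exists_blockMap J
  obtain ⟨st, hst⟩ := hsurj.hasRightInverse
  have hstm : StrictMono st := fun x y hxy => by
    by_contra! hle
    have := hb hle
    rw [hst, hst] at this
    exact absurd hxy this.not_gt
  have hcard : (univ : Finset (Fin (m + 1 - J.card) → Fin N)).card = N ^ (m + 1 - J.card) := by
    simp
  rw [← hcard]
  symm
  refine card_bij'
    (fun f _ => (f ∘ Tuple.sort f ∘ b, (Tuple.sort (Tuple.sort f ∘ b))⁻¹))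
    (fun x _ => x.1 ∘ st ∘ Tuple.sort (x.2 ∘ st)) ?_ ?_ ?_ ?_
  · intro f _
    obtain ⟨hm, ht⟩ := Tuple.eq_sort_iff.1 (rfl : Tuple.sort f = Tuple.sort f)
    have hinc (i : Fin m) (hi : b i.castSucc = b i.succ) :
        (Tuple.sort (Tuple.sort f ∘ b))⁻¹ i.castSucc < (Tuple.sort (Tuple.sort f ∘ b))⁻¹ i.succ :=
      (sort_inv_lt_iff _ _ _).2 (Or.inr ⟨by simp [hi], Fin.castSucc_lt_succ⟩)
    simp only [blockPairs, mem_filter, mem_univ, true_and]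
    refine ⟨hm.comp hb, fun i hi => ?_, fun i hi => ?_, fun i hi => ?_⟩
    · simp [mem_levelAdj, (hbJ i).2 hi]
    · rcases (hb (Fin.castSucc_lt_succ (i := i)).le).lt_or_eq with h | h
      · exact (sort_inv_lt_iff _ _ _).2 (Or.inl (ht _ _ h (mem_levelAdj.1 hi)))
      · exact hinc i h
    · have hbi := (hbJ i).2 hi
      have h1 := hinc i hbi
      set w := (Tuple.sort (Tuple.sort f ∘ b))⁻¹ with hw
      by_contra hne
      obtain ⟨q, hq⟩ := w.surjective ⟨w i.castSucc + 1, by rw [Fin.lt_def] at h1; omega⟩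
      have h2 : w i.castSucc < w q := by rw [hq, Fin.lt_def]; simp
      have h3 : w q < w i.succ := by
        rw [hq]
        rw [Fin.lt_def] at h1 ⊢
        simp only
        omega
      rw [hw, sort_inv_lt_iff] at h2 h3
      simp only [Function.comp_apply, hbi, Fin.lt_def, Fin.val_castSucc, Fin.val_succ] at h2 h3
      omega
  · simp
  · intro f _
    obtain ⟨hm, ht⟩ := Tuple.eq_sort_iff.1 (rfl : Tuple.sort f = Tuple.sort f)
    have hsort : (Tuple.sort f)⁻¹ = Tuple.sort (⇑(Tuple.sort (Tuple.sort f ∘ b))⁻¹ ∘ st) := by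
      have : StrictMono ((⇑(Tuple.sort (Tuple.sort f ∘ b))⁻¹ ∘ st) ∘ ⇑(Tuple.sort f)⁻¹) := by
        intro x y hxy
        refine (sort_inv_lt_iff _ _ _).2 (Or.inl ?_)
        simpa [hst _] using hxy
      exact Tuple.eq_sort_iff.2 ⟨this.monotone, fun i j hij he => absurd he (this hij).ne⟩
    funext x
    simp only [← hsort, Function.comp_apply, hst _, apply_inv_apply]
  · rintro ⟨g, w⟩ hx
    simp only [blockPairs, mem_filter, mem_univ, true_and] at hx
    obtain ⟨hg, hJ, hinc, htake⟩ := hx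
    have hw (i : Fin m) (hi : b i.castSucc = b i.succ) := htake i ((hbJ i).1 hi)
    set σ := Tuple.sort (w ∘ st) with hσ
    have hsort : σ⁻¹ = Tuple.sort (g ∘ st ∘ σ) := by
      have hcomp : (g ∘ st ∘ σ) ∘ ⇑σ⁻¹ = g ∘ st := by funext x; simp
      rw [Tuple.eq_sort_iff, hcomp]
      refine ⟨hg.comp hstm.monotone, fun i j hij he => ?_⟩
      rw [hσ, sort_inv_lt_iff]
      refine Or.inl (lt_of_levelAdj hg hinc (hstm hij) ?_)
      simpa using he
    simp only [← hsort]
    refine Prod.ext ?_ ?_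
    · funext p
      simp only [Function.comp_apply, apply_inv_apply]
      have key := rel_of_adjacent hb (fun x y => g x = g y) (fun _ _ _ => Eq.trans)
        (fun i hi => mem_levelAdj.1 (hJ ((hbJ i).1 hi)))
      have he : b (st (b p)) = b p := hst _
      rcases lt_trichotomy (st (b p)) p with h | h | h
      · exact key _ _ h he
      · rw [h]
      · exact (key _ _ h he.symm).symm
    · symm
      refine eq_sort_inv fun p q h => ?_
      have hst' (x) : b (st (b x)) = b x := hst _
      by_cases hpq : b p = b q
      · have hlt : p < q := by simpa [hpq] using h
        exact rel_of_adjacent hb (fun x y => w x < w y) (fun _ _ _ => lt_trans)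
          (fun i hi => by rw [Fin.lt_def]; have := hw i hi; omega) p q hlt hpq
      · have hlt : σ⁻¹ (b p) < σ⁻¹ (b q) := by simpa [hpq] using h
        rw [hσ, sort_inv_lt_iff] at hlt
        have hlt' : w (st (b p)) < w (st (b q)) := by
          rcases hlt with h1 | ⟨h1, -⟩
          · exact h1
          · exact absurd (hstm.injective (w.injective h1)) hpq
        exact block_lt hb hw (hst' p) (hst' q) (by rwa [hst', hst']) hlt'

lemma sortSum_eq_sum_pow {e : Finset (Perm (Fin (m + 1))) → MonoidAlgebra ℂ (Perm (Fin (m + 1)))}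
    (he : IsBBHT (m + 1) Set.univ (Simples (m + 1)) e) (N : ℕ) :
    sortSum m N = ∑ J : Finset (Fin m), (N : ℂ) ^ (m + 1 - J.card) • e (reflSet J) := by
  have hx (K : Finset (Fin m)) : xRel (m + 1) Set.univ (reflSet K) =
      ∑ J : Finset (Fin m), if J ⊆ K then
        ((((minCoset (m + 1) Set.univ (reflSet K)).filter
          fun w => ∀ i ∈ J, (w i.succ : ℕ) = w i.castSucc + 1).card : ℂ) • e (reflSet J)) else 0 := by
    rw [he (reflSet K) (mem_powerset.2 (reflSet_univ (m := m) ▸ reflSet_subset.2 (subset_univ K))),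
      powerset_reflSet, sum_image reflSet_injective.injOn, ← sum_filter]
    refine sum_congr (by ext; simp) fun J hJ => ?_
    have hJK : J ⊆ K := by simpa using hJ
    rw [mC, if_pos (reflSet_subset.2 hJK)]
    simp only [takes_reflSet]
  rw [sortSum_eq_sum_xRel]
  simp only [hx]
  rw [sum_comm]
  refine sum_congr rfl fun J _ => ?_
  rw [← Nat.cast_pow, ← card_blockPairs, ← sum_filter, ← sum_smul, ← Nat.cast_sum, ← card_sigma]
  congr 2
  refine card_nbij' (fun x => (x.1, x.2)) (fun x => ⟨x.1, x.2⟩) ?_ ?_ ?_ ?_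
  · rintro ⟨g, w⟩ h
    simpa [blockPairs, mem_minCoset_reflSet, and_assoc] using h
  · rintro ⟨g, w⟩ h
    simpa [blockPairs, mem_minCoset_reflSet, and_assoc] using h
  · intro x _; rfl
  · intro x _; rfl

end Blocks

section Counting

lemma exists_polynomial_card {α : Type*} [Fintype α] [Nonempty α] (R T : α → α → Prop) :
    ∃ Q : Polynomial ℂ, Q.coeff 0 = 0 ∧ ∀ N : ℕ,
      ((univ.filter fun f : α → Fin N => ∀ a b, R a b → f a < f b ∨ f a = f b ∧ T a b).card : ℂ) =
        Q.eval (N : ℂ) := by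
  set a : ℕ → ℕ := fun r => (univ.filter fun f : α → Fin r =>
    (∀ a b, R a b → f a < f b ∨ f a = f b ∧ T a b) ∧ Function.Surjective f).card with ha
  have hcount (N : ℕ) : (univ.filter fun f : α → Fin N =>
      ∀ a b, R a b → f a < f b ∨ f a = f b ∧ T a b).card =
      ∑ r ∈ range (N + 1), N.choose r * a r := by
    rw [card_eq_sum_card_fiberwise (f := fun f => univ.image f) (t := univ) (by simp)]
    have := sum_powerset_apply_card a (x := (univ : Finset (Fin N)))
    simp only [powerset_univ, card_univ, Fintype.card_fin, smul_eq_mul] at this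
    rw [← this]
    refine sum_congr rfl fun S _ => ?_
    symm
    have hmem (f : α → Fin S.card) (x : α) : S.orderEmbOfFin rfl (f x) ∈ S :=
      orderEmbOfFin_mem S rfl _
    refine card_nbij (fun f x => S.orderEmbOfFin rfl (f x)) ?_ ?_ ?_
    · intro f hf
      simp only [coe_filter, mem_univ, true_and, Set.mem_ofPred_eq, mem_filter] at hf ⊢
      refine ⟨fun a b hab => by simpa using hf.1 a b hab, ?_⟩
      ext y
      simp only [mem_image, mem_univ, true_and]
      constructor
      · rintro ⟨x, rfl⟩
        exact hmem f x
      · intro hy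
        obtain ⟨i, rfl⟩ : y ∈ Set.range (S.orderEmbOfFin rfl) := by simpa using hy
        obtain ⟨x, rfl⟩ := hf.2 i
        exact ⟨x, rfl⟩
    · intro f _ g _ hfg
      funext x
      exact (S.orderEmbOfFin rfl).injective (congrFun hfg x)
    · intro g hg
      simp only [coe_filter, mem_filter, mem_univ, true_and, Set.mem_ofPred_eq] at hg
      obtain ⟨hg, himg⟩ := hg
      have hx (x : α) : ∃ i, S.orderEmbOfFin rfl i = g x := by
        have : g x ∈ S := himg ▸ mem_image_of_mem g (mem_univ x)
        have : g x ∈ Set.range (S.orderEmbOfFin rfl) := by simpa using this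
        exact this
      choose f hf using hx
      refine ⟨f, ?_, funext hf⟩
      simp only [coe_filter, mem_univ, true_and, Set.mem_ofPred_eq]
      refine ⟨fun a b hab => ?_, fun i => ?_⟩
      · have := hg a b hab
        rw [← hf a, ← hf b] at this
        simpa using this
      · have : S.orderEmbOfFin rfl i ∈ univ.image g := himg ▸ orderEmbOfFin_mem S rfl i
        obtain ⟨x, -, hx⟩ := mem_image.1 this
        exact ⟨x, (S.orderEmbOfFin rfl).injective ((hf x).trans hx)⟩
  have hlarge (r : ℕ) (hr : Fintype.card α < r) : a r = 0 := by
    rw [ha, card_eq_zero, filter_eq_empty_iff]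
    rintro f - ⟨-, hf⟩
    have := Fintype.card_le_of_surjective f hf
    rw [Fintype.card_fin] at this
    omega
  set Q : Polynomial ℂ := ∑ r ∈ range (Fintype.card α + 1),
    Polynomial.C ((a r : ℂ) / (r.factorial : ℂ)) * descPochhammer ℂ r with hQ
  have heval (N : ℕ) : ((univ.filter fun f : α → Fin N =>
      ∀ a b, R a b → f a < f b ∨ f a = f b ∧ T a b).card : ℂ) = Q.eval (N : ℂ) := by
    rw [hcount, hQ, Polynomial.eval_finsetSum]
    push_cast
    have h1 : ∑ r ∈ range (N + 1), (N.choose r : ℂ) * (a r : ℂ) =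
        ∑ r ∈ range (N + Fintype.card α + 1), (N.choose r : ℂ) * (a r : ℂ) := by
      refine sum_subset (range_mono (by omega)) fun r _ hr => ?_
      rw [Nat.choose_eq_zero_of_lt (by simpa using hr)]
      simp
    have h2 : ∑ r ∈ range (Fintype.card α + 1), (N.choose r : ℂ) * (a r : ℂ) =
        ∑ r ∈ range (N + Fintype.card α + 1), (N.choose r : ℂ) * (a r : ℂ) := by
      refine sum_subset (range_mono (by omega)) fun r _ hr => ?_
      rw [hlarge r (by simpa using hr)]
      simp
    rw [h1, ← h2]
    refine sum_congr rfl fun r _ => ?_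
    rw [Nat.cast_choose_eq_descPochhammer_div, Polynomial.eval_mul, Polynomial.eval_C]
    ring
  refine ⟨Q, ?_, heval⟩
  have h0 := heval 0
  rw [Nat.cast_zero] at h0
  rw [Polynomial.coeff_zero_eq_eval_zero, ← h0, Nat.cast_eq_zero, card_eq_zero]
  exact filter_eq_empty_iff.2 fun f _ => (f (Classical.arbitrary α)).elim0

lemma card_filter_strictMono (m N : ℕ) :
    (univ.filter fun f : Fin m → Fin N => StrictMono f).card = N.choose m := by
  have : (powersetCard m (univ : Finset (Fin N))).card = N.choose m := by simp
  rw [← this]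
  refine card_nbij (fun f => univ.image f) ?_ ?_ ?_
  · intro f hf
    simp only [coe_filter, mem_univ, true_and, Set.mem_ofPred_eq] at hf
    rw [mem_coe, mem_powersetCard]
    exact ⟨subset_univ _, by rw [card_image_of_injective _ hf.injective, card_univ,
      Fintype.card_fin]⟩
  · intro f hf g hg hfg
    simp only [coe_filter, mem_univ, true_and, Set.mem_ofPred_eq] at hf hg
    refine (StrictMono.range_inj hf hg).1 ?_
    simpa using congrArg (fun S : Finset (Fin N) => (S : Set (Fin N))) hfg
  · intro S hS
    have hc := (mem_powersetCard.1 hS).2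
    refine ⟨S.orderEmbOfFin hc, by simpa using (S.orderEmbOfFin hc).strictMono, ?_⟩
    apply coe_injective
    simp

variable {m : ℕ}

lemma eq_coeff_one_of_eval (a : Finset (Fin m) → ℂ) (Q : Polynomial ℂ)
    (h : ∀ N : ℕ, ∑ J, (N : ℂ) ^ (m + 1 - J.card) * a J = Q.eval (N : ℂ)) :
    a univ = Q.coeff 1 := by
  have hp : (∑ J, Polynomial.X ^ (m + 1 - J.card) * Polynomial.C (a J)) = Q := by
    refine Polynomial.eq_of_infinite_eval_eq _ _ ?_
    refine Set.Infinite.mono ?_ (Set.infinite_range_of_injective (Nat.cast_injective (R := ℂ)))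
    rintro _ ⟨N, rfl⟩
    rw [Set.mem_ofPred_eq, ← h, Polynomial.eval_finsetSum]
    simp only [Polynomial.eval_mul, Polynomial.eval_pow, Polynomial.eval_X, Polynomial.eval_C]
  rw [← hp, Polynomial.finsetSum_coeff, sum_eq_single univ]
  · simp
  · intro J _ hJ
    have : J.card < m := by
      simpa using card_lt_univ_of_notMem (not_forall.1 (mt eq_univ_iff_forall.2 hJ)).choose_spec
    rw [mul_comm, Polynomial.coeff_C_mul, Polynomial.coeff_X_pow, if_neg (by omega), mul_zero]
  · simp

lemma descPochhammer_coeff_one_ne_zero (m : ℕ) : (descPochhammer ℂ (m + 1)).coeff 1 ≠ 0 := by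
  rw [descPochhammer_succ_left, Polynomial.coeff_X_mul, Polynomial.coeff_zero_eq_eval_zero,
    Polynomial.eval_comp]
  simp only [Polynomial.eval_sub, Polynomial.eval_X, Polynomial.eval_one, zero_sub]
  intro h
  have h1 := ascPochhammer_eval_neg_eq_descPochhammer ℂ (-1) m
  rw [h, mul_zero, neg_neg, ascPochhammer_eval_one] at h1
  exact Nat.factorial_ne_zero m (by exact_mod_cast h1)

end Counting

section LieElement

variable {m : ℕ} {e : Finset (Perm (Fin (m + 1))) → MonoidAlgebra ℂ (Perm (Fin (m + 1)))}

lemma coeff_apply_top_mul (he : IsBBHT (m + 1) Set.univ (Simples (m + 1)) e)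
    (G : MonoidAlgebra ℂ (Perm (Fin (m + 1)))) (v : Perm (Fin (m + 1))) (Q : Polynomial ℂ)
    (h : ∀ N : ℕ, (sortSum m N * G).coeff v = Q.eval (N : ℂ)) :
    (e (Simples (m + 1)) * G).coeff v = Q.coeff 1 := by
  rw [← reflSet_univ]
  refine eq_coeff_one_of_eval (fun J => (e (reflSet J) * G).coeff v) Q fun N => ?_
  rw [← h, sortSum_eq_sum_pow he, sum_mul, coeff_sum, Finsupp.finsetSum_apply]
  simp [coeff_smul]

lemma sort_eq_revPerm_iff {N : ℕ} (f : Fin (m + 1) → Fin N) :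
    Tuple.sort f = Fin.revPerm ↔ StrictMono (f ∘ Fin.revPerm) := by
  rw [eq_comm, Tuple.eq_sort_iff]
  constructor
  · rintro ⟨h1, h2⟩
    refine fun i j hij => lt_of_le_of_ne (h1 hij.le) fun h => ?_
    have := h2 i j hij h
    simp only [Fin.revPerm_apply, Fin.rev_lt_rev] at this
    exact this.asymm hij
  · exact fun h => ⟨h.monotone, fun i j hij hf => absurd hf (h hij).ne⟩

lemma apply_top_ne_zero (he : IsBBHT (m + 1) Set.univ (Simples (m + 1)) e) :
    e (Simples (m + 1)) ≠ 0 := by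
  intro h0
  have hcoef := coeff_apply_top_mul he 1 Fin.revPerm
    (Polynomial.C (((m + 1).factorial : ℂ)⁻¹) * descPochhammer ℂ (m + 1)) fun N => by
      rw [mul_one, Polynomial.eval_mul, Polynomial.eval_C, inv_mul_eq_div,
        ← Nat.cast_choose_eq_descPochhammer_div, ← card_filter_strictMono, sortSum, coeff_sum,
        Finsupp.finsetSum_apply]
      simp only [of_apply, coeff_single, Finsupp.single_apply, sum_boole, sort_eq_revPerm_iff]
      congr 1
      exact card_equiv (Fin.revPerm.arrowCongr (Equiv.refl _)) fun _ => by
        simp only [mem_filter, mem_univ, true_and]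
        rfl
  rw [h0, Polynomial.coeff_C_mul] at hcoef
  simp [Nat.factorial_ne_zero, descPochhammer_coeff_one_ne_zero] at hcoef

end LieElement
section Hook

/-- The permutations fixing every point `≥ M`, decreasing on the first `k` points and increasing
on the points from `k` to `M - 1`. -/
def hookSet (n M k : ℕ) : Finset (Perm (Fin n)) :=
  univ.filter fun w => k ≤ M ∧ (∀ p : Fin n, M ≤ (p : ℕ) → w p = p) ∧
    (∀ p q : Fin n, p < q → (q : ℕ) < k → w q < w p) ∧
    ∀ p q : Fin n, p < q → k ≤ (p : ℕ) → (q : ℕ) < M → w p < w q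

lemma mem_hookSet {n M k : ℕ} {w : Perm (Fin n)} : w ∈ hookSet n M k ↔
    k ≤ M ∧ (∀ p : Fin n, M ≤ (p : ℕ) → w p = p) ∧
    (∀ p q : Fin n, p < q → (q : ℕ) < k → w q < w p) ∧
    ∀ p q : Fin n, p < q → k ≤ (p : ℕ) → (q : ℕ) < M → w p < w q := by
  simp [hookSet]

/-- The sum of `hookSet n M k` in the group algebra. -/
def hookSum (n M k : ℕ) : MonoidAlgebra ℂ (Perm (Fin n)) :=
  ∑ w ∈ hookSet n M k, of ℂ _ w

variable {m : ℕ}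

lemma coeff_sortSum_mul_hookSum (N k : ℕ) (v : Perm (Fin (m + 1))) :
    (sortSum m N * hookSum (m + 1) (m + 1) k).coeff v =
      ((univ.filter fun g : Fin (m + 1) → Fin N =>
        (Tuple.sort (g ∘ (v⁻¹ : Perm (Fin (m + 1)))))⁻¹ * v ∈
          hookSet (m + 1) (m + 1) k).card : ℂ) := by
  have h1 (f : Fin (m + 1) → Fin N) :
      (of ℂ _ (Tuple.sort f) * hookSum (m + 1) (m + 1) k).coeff v =
        if (Tuple.sort f)⁻¹ * v ∈ hookSet (m + 1) (m + 1) k then 1 else 0 := by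
    rw [hookSum, mul_sum, coeff_sum, Finsupp.finsetSum_apply]
    have (w : Perm (Fin (m + 1))) : (of ℂ _ (Tuple.sort f) * of ℂ _ w).coeff v =
        if w = (Tuple.sort f)⁻¹ * v then 1 else 0 := by
      rw [← map_mul, of_apply, coeff_single, Finsupp.single_apply]
      simp only [eq_inv_mul_iff_mul_eq]
    simp only [this, sum_ite_eq']
  rw [sortSum, sum_mul, coeff_sum, Finsupp.finsetSum_apply, sum_congr rfl fun f _ => h1 f,
    sum_boole]
  congr 1
  refine card_equiv (v.symm.arrowCongr (Equiv.refl _)) fun f => ?_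
  simp only [mem_filter, mem_univ, true_and]
  have : ((v.symm.arrowCongr (Equiv.refl _)) f ∘ (v⁻¹ : Perm (Fin (m + 1))) :
      Fin (m + 1) → Fin N) = f := by
    funext x
    change f (v (v⁻¹ x)) = f x
    rw [apply_inv_apply]
  rw [this]

variable {e : Finset (Perm (Fin (m + 1))) → MonoidAlgebra ℂ (Perm (Fin (m + 1)))}

lemma apply_top_mul_hookSum (he : IsBBHT (m + 1) Set.univ (Simples (m + 1)) e) {k : ℕ}
    (hk : 1 ≤ k) (hkm : k ≤ m) : e (Simples (m + 1)) * hookSum (m + 1) (m + 1) k = 0 := by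
  refine MonoidAlgebra.ext (Finsupp.ext fun v => ?_)
  have : Nonempty {p : Fin (m + 1) // (p : ℕ) < k} := ⟨⟨0, hk⟩⟩
  have : Nonempty {p : Fin (m + 1) // ¬ (p : ℕ) < k} := ⟨⟨Fin.last m, by simpa using hkm⟩⟩
  obtain ⟨Q₁, h₁, hQ₁⟩ := exists_polynomial_card
    (fun a b : {p : Fin (m + 1) // (p : ℕ) < k} => b < a) (fun a b => v a < v b)
  obtain ⟨Q₂, h₂, hQ₂⟩ := exists_polynomial_card
    (fun a b : {p : Fin (m + 1) // ¬ (p : ℕ) < k} => a < b) (fun a b => v a < v b)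
  rw [coeff_apply_top_mul he _ v (Q₁ * Q₂), Polynomial.mul_coeff_one, h₁, h₂]
  · simp
  intro N
  rw [coeff_sortSum_mul_hookSum, Polynomial.eval_mul, ← hQ₁, ← hQ₂, ← Nat.cast_mul, ← card_product]
  congr 1
  refine card_equiv (Equiv.piEquivPiSubtypeProd (fun p : Fin (m + 1) => (p : ℕ) < k) _)
    fun g => ?_
  simp only [mem_filter, mem_univ, true_and, mem_product, mem_hookSet, Perm.mul_apply,
    sort_inv_lt_iff, Function.comp_apply, inv_apply_apply, Equiv.piEquivPiSubtypeProd_apply]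
  constructor
  · rintro ⟨-, -, hd, hi⟩
    exact ⟨fun a b hab => hd b a hab a.2, fun a b hab => hi a b hab (not_lt.1 a.2) b.1.2⟩
  · rintro ⟨hd, hi⟩
    refine ⟨by omega, fun p hp => absurd p.2 (not_lt.2 hp), fun p q hpq hq => ?_,
      fun p q hpq hp hq => ?_⟩
    · exact hd ⟨q, hq⟩ ⟨p, (Fin.lt_def.1 hpq).trans hq⟩ hpq
    · exact hi ⟨p, not_lt.2 hp⟩ ⟨q, not_lt.2 (hp.trans (Fin.lt_def.1 hpq).le)⟩ hpq

end Hook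
section Recurrence

variable {n : ℕ}

lemma cgen_succ (i : ℕ) : cgen n (i + 1 + 1) = sgen n (i + 1) * cgen n (i + 1) := by
  simp [cgen, List.range_succ]

lemma cgen_apply_val {i : ℕ} (hi : i < n) (p : Fin n) : (cgen n (i + 1) p : ℕ) =
    if (p : ℕ) = 0 then i else if (p : ℕ) ≤ i then (p : ℕ) - 1 else p := by
  induction i with
  | zero =>
    have : cgen n (0 + 1) = 1 := by simp [cgen]
    rw [this, Perm.one_apply]
    split_ifs <;> omega
  | succ i ih =>
    have hs (q : Fin n) : (sgen n (i + 1) q : ℕ) =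
        if (q : ℕ) = i then i + 1 else if (q : ℕ) = i + 1 then i else q := by
      rw [sgen, dif_pos ⟨i.succ_pos, hi⟩, Equiv.swap_apply_def]
      simp only [Fin.ext_iff, Nat.add_sub_cancel]
      split_ifs <;> rfl
    rw [cgen_succ, Perm.mul_apply, hs, ih (by omega)]
    split_ifs <;> omega

lemma apply_lt_of_fix {M : ℕ} {w : Perm (Fin n)} (hw : ∀ p : Fin n, M ≤ (p : ℕ) → w p = p)
    {p : Fin n} (hp : (p : ℕ) < M) : (w p : ℕ) < M := by
  by_contra! h
  have := w.injective (hw _ h)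
  omega

lemma hookSet_zero_right {M : ℕ} : hookSet n M 0 = {1} := by
  ext w
  rw [mem_hookSet, mem_singleton]
  constructor
  · rintro ⟨-, hf, -, hi⟩
    have hmono : StrictMono w := by
      intro p q hpq
      by_cases hq : (q : ℕ) < M
      · exact hi p q hpq (Nat.zero_le _) hq
      · by_cases hp : (p : ℕ) < M
        · have := apply_lt_of_fix hf hp
          rw [hf q (not_lt.1 hq)]
          omega
        · rwa [hf q (not_lt.1 hq), hf p (not_lt.1 hp)]
    have h := Subsingleton.elim (hmono.orderIsoOfSurjective w w.surjective) (OrderIso.refl _)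
    ext p
    exact congrArg (fun f : Fin n ≃o Fin n => (f p : ℕ)) h
  · rintro rfl
    exact ⟨Nat.zero_le _, fun _ _ => rfl, fun _ _ _ h => absurd h (Nat.not_lt_zero _),
      fun _ _ h _ _ => h⟩

lemma hookSum_zero_right {M : ℕ} : hookSum n M 0 = 1 := by
  rw [hookSum, hookSet_zero_right, sum_singleton, map_one]

lemma hookSum_of_lt {M k : ℕ} (h : M < k) : hookSum n M k = 0 := by
  rw [hookSum, sum_eq_zero]
  intro w hw
  have := (mem_hookSet.1 hw).1
  omega

lemma mul_cgen_mem_hookSet_iff {M k : ℕ} (hM : M < n) {w : Perm (Fin n)} :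
    w * cgen n (M + 1) ∈ hookSet n (M + 1) (k + 1) ∧
      (w * cgen n (M + 1)) ⟨0, by omega⟩ = ⟨M, hM⟩ ↔ w ∈ hookSet n M k := by
  have hc := cgen_apply_val hM
  set c := cgen n (M + 1)
  have hc0 : c ⟨0, by omega⟩ = ⟨M, hM⟩ := Fin.ext (by rw [hc]; simp)
  have hcs (p : Fin n) (hp : (p : ℕ) < M) : c ⟨p + 1, by omega⟩ = p := by
    refine Fin.ext ?_
    rw [hc, if_neg (by simp), if_pos (by simpa using hp)]
    simp
  have hcg (p : Fin n) (hp : M < p) : c p = p := by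
    refine Fin.ext ?_
    rw [hc, if_neg (by omega), if_neg (by omega)]
  simp only [mem_hookSet, Perm.mul_apply, hc0]
  constructor
  · rintro ⟨⟨hk, hf, hd, hi⟩, h0⟩
    refine ⟨by omega, fun p hp => ?_, fun p q hpq hq => ?_, fun p q hpq hp hq => ?_⟩
    · rcases hp.eq_or_lt with hp | hp
      · obtain rfl : p = ⟨M, hM⟩ := Fin.ext hp.symm
        exact h0
      · rw [← hcg p hp, hf p hp, hcg p hp]
    · have := hd ⟨p + 1, by omega⟩ ⟨q + 1, by omega⟩ (by simpa using hpq) (by simpa using hq)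
      rwa [hcs p (by omega), hcs q (by omega)] at this
    · have := hi ⟨p + 1, by omega⟩ ⟨q + 1, by omega⟩ (by simpa using hpq) (by simpa using hp)
        (by simpa using hq)
      rwa [hcs p (by omega), hcs q (by omega)] at this
  · rintro ⟨hk, hf, hd, hi⟩
    refine ⟨⟨by omega, fun p hp => ?_, fun p q hpq hq => ?_, fun p q hpq hp hq => ?_⟩,
      hf _ le_rfl⟩
    · rw [hcg p hp, hf p (by omega)]
    · have hcq := hc q
      rw [if_neg (by omega), if_pos (by omega)] at hcq
      by_cases hp : (p : ℕ) = 0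
      · have hp' : p = ⟨0, by omega⟩ := Fin.ext hp
        rw [hp', hc0, hf ⟨M, hM⟩ le_rfl]
        exact apply_lt_of_fix hf (by omega)
      · have hcp := hc p
        rw [if_neg hp, if_pos (by omega)] at hcp
        exact hd _ _ (by omega) (by omega)
    · have hcq := hc q
      have hcp := hc p
      rw [if_neg (by omega), if_pos (by omega)] at hcq hcp
      exact hi _ _ (by omega) (by omega) (by omega)

lemma hookSet_succ_succ {M k : ℕ} (hM : M < n) : hookSet n (M + 1) (k + 1) =
    hookSet n M (k + 1) ∪ (hookSet n M k).image (· * cgen n (M + 1)) := by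
  ext x
  rw [mem_union, mem_image]
  constructor
  · intro hx
    obtain ⟨hk, hf, hd, hi⟩ := mem_hookSet.1 hx
    obtain ⟨a, ha⟩ := x.surjective ⟨M, hM⟩
    have haM : (a : ℕ) ≤ M := by
      by_contra! h
      rw [hf a h] at ha
      simp [ha] at h
    have hle (b : Fin n) (hb : (b : ℕ) ≤ M) : x b ≤ x a := by
      rw [ha]
      have := apply_lt_of_fix hf (Nat.lt_succ_of_le hb)
      exact Fin.le_def.2 (Nat.le_of_lt_succ this)
    by_cases ha0 : (a : ℕ) = 0
    · right
      have ha' : a = ⟨0, by omega⟩ := Fin.ext ha0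
      rw [ha'] at ha
      refine ⟨x * (cgen n (M + 1))⁻¹, ?_, by simp⟩
      rw [← mul_cgen_mem_hookSet_iff hM, inv_mul_cancel_right]
      exact ⟨hx, ha⟩
    · left
      have hak : k + 1 ≤ (a : ℕ) := by
        by_contra! h
        exact (hd ⟨0, by omega⟩ a (Fin.lt_def.2 (by simp; omega)) h).not_ge (hle _ (by simp))
      have haM' : (a : ℕ) = M := by
        by_contra! h
        exact (hi a ⟨M, hM⟩ (Fin.lt_def.2 (by simp; omega)) hak (by simp)).not_ge (hle _ le_rfl)
      rw [mem_hookSet]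
      refine ⟨by omega, fun p hp => ?_, hd, fun p q hpq hp hq => hi p q hpq hp (by omega)⟩
      rcases hp.eq_or_lt with hp | hp
      · obtain rfl : p = a := Fin.ext (by omega)
        rw [ha]
        exact Fin.ext haM'.symm
      · exact hf p hp
  · rintro (hx | ⟨w, hw, rfl⟩)
    · obtain ⟨hk, hf, hd, hi⟩ := mem_hookSet.1 hx
      rw [mem_hookSet]
      refine ⟨by omega, fun p hp => hf p (by omega), hd, fun p q hpq hp hq => ?_⟩
      by_cases hqM : (q : ℕ) < M
      · exact hi p q hpq hp hqM
      · rw [hf q (by omega)]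
        have := apply_lt_of_fix hf (p := p) (by omega)
        omega
    · exact ((mul_cgen_mem_hookSet_iff hM).2 hw).1

lemma hookSum_succ_succ {M k : ℕ} (hM : M < n) : hookSum n (M + 1) (k + 1) =
    hookSum n M (k + 1) + hookSum n M k * of ℂ _ (cgen n (M + 1)) := by
  rw [hookSum, hookSet_succ_succ hM, sum_union, sum_image (fun _ _ _ _ h => mul_right_cancel h)]
  · simp only [hookSum, map_mul, sum_mul]
  · rw [disjoint_left]
    intro x hx hx'
    obtain ⟨w, hw, rfl⟩ := mem_image.1 hx'
    obtain ⟨hk, hf, -⟩ := mem_hookSet.1 hx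
    have h0 := ((mul_cgen_mem_hookSet_iff hM).2 hw).2
    have := congrArg Fin.val ((w * cgen n (M + 1)).injective (h0.trans (hf ⟨M, hM⟩ le_rfl).symm))
    simp at this
    omega

lemma prod_one_sub_smul_cgen (ζ : ℂ) {M : ℕ} (hM : M ≤ n) :
    ((List.range M).map fun i => 1 - ζ • of ℂ (Perm (Fin n)) (cgen n (i + 1))).prod =
      ∑ k ∈ range (M + 1), (-ζ) ^ k • hookSum n M k := by
  induction M with
  | zero => simp [hookSum_zero_right]
  | succ M ih =>
    have h : ∑ k ∈ range (M + 1), (-ζ) ^ k • hookSum n M k =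
        ∑ k ∈ range (M + 1), (-ζ) ^ (k + 1) • hookSum n M (k + 1) + 1 := by
      have h1 := sum_range_succ (fun k => (-ζ) ^ k • hookSum n M k) (M + 1)
      rw [hookSum_of_lt M.lt_succ_self, smul_zero, add_zero] at h1
      rw [← h1, sum_range_succ', hookSum_zero_right, pow_zero, one_smul]
    rw [List.range_succ, List.map_append, List.prod_append, ih (by omega), List.map_singleton,
      List.prod_singleton, mul_sub, mul_one, sum_range_succ' _ (M + 1), hookSum_zero_right,
      pow_zero, one_smul]
    simp only [hookSum_succ_succ (show M < n by omega), smul_add, sum_add_distrib]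
    rw [add_right_comm, ← h, sub_eq_add_neg, sum_mul, ← sum_neg_distrib]
    congr 1
    refine sum_congr rfl fun k _ => ?_
    rw [pow_succ, mul_neg, neg_smul, mul_smul, smul_mul_assoc, mul_smul_comm]

lemma cgen_pow_self {i : ℕ} (hi : i < n) : cgen n (i + 1) ^ (i + 1) = 1 := by
  have : NeZero n := ⟨by omega⟩
  have h : cgen n (i + 1) = (Fin.cycleRange ⟨i, hi⟩)⁻¹ := by
    rw [eq_inv_iff_mul_eq_one]
    ext p
    rw [Perm.mul_apply, cgen_apply_val hi, Perm.one_apply]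
    rcases lt_trichotomy p ⟨i, hi⟩ with hp | hp | hp
    · have hlt : (p : ℕ) < i := hp
      rw [Fin.coe_cycleRange_of_lt hp, if_neg (Nat.succ_ne_zero _),
        if_pos (Nat.succ_le_of_lt hlt), Nat.add_sub_cancel]
    · rw [Fin.cycleRange_of_eq hp, hp]
      simp
    · rw [Fin.cycleRange_of_gt hp]
      have : i < (p : ℕ) := hp
      split_ifs <;> omega
  rw [h, inv_pow, inv_eq_one]
  by_cases h0 : i = 0
  · subst h0
    simp
  · rw [← orderOf_dvd_iff_pow_eq_one, ← Perm.lcm_cycleType, Fin.cycleType_cycleRange]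
    · simp
    · simpa [Fin.ext_iff] using h0

end Recurrence
section Idempotent

lemma isUnit_one_sub_smul_of {G : Type*} [Group G] {g : G} {ζ : ℂ} {i : ℕ} (hg : g ^ i = 1)
    (hζ : ζ ^ i ≠ 1) : IsUnit (1 - ζ • of ℂ G g) := by
  have hpow : (ζ • of ℂ G g) ^ i = ζ ^ i • (1 : MonoidAlgebra ℂ G) := by
    rw [smul_pow, ← map_pow, hg, map_one]
  have hcomm : Commute (1 - ζ • of ℂ G g) (∑ j ∈ range i, (ζ • of ℂ G g) ^ j) :=
    Commute.sum_right _ _ _ fun j _ => ((Commute.one_left _).sub_left (Commute.refl _)).pow_right j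
  refine (hcomm.isUnit_mul_iff.1 ?_).1
  rw [mul_neg_geom_sum, hpow, ← one_smul ℂ (1 : MonoidAlgebra ℂ G), smul_smul, mul_one, ← sub_smul,
    ← Algebra.algebraMap_eq_smul_one]
  exact (IsUnit.mk0 _ (sub_ne_zero.2 hζ.symm)).map (algebraMap ℂ (MonoidAlgebra ℂ G))

lemma sum_inv_pow_smul_of {G : Type*} [Group G] {g : G} {ζ : ℂ} {n : ℕ} (hg : g ^ n = 1)
    (hζ : ζ ^ n = 1) : ∑ k ∈ range n, (ζ⁻¹) ^ k • of ℂ G ((g⁻¹) ^ k) =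
      ∑ k ∈ range n, ζ ^ k • of ℂ G (g ^ k) := by
  rcases n with _ | m
  · simp
  rw [sum_range_succ', sum_range_succ', ← sum_range_reflect _ m]
  simp only [pow_zero]
  congr 1
  refine sum_congr rfl fun k hk => ?_
  have hk' : m - 1 - k + 1 + (k + 1) = m + 1 := by
    have := mem_range.1 hk
    omega
  rw [← hk', pow_add] at hg hζ
  congr 1
  · rw [inv_pow, inv_eq_of_mul_eq_one_right]
    exact hζ
  · rw [inv_pow, inv_eq_of_mul_eq_one_right hg]

variable {m : ℕ} {e : Finset (Perm (Fin (m + 1))) → MonoidAlgebra ℂ (Perm (Fin (m + 1)))}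

lemma apply_top_mul_hookSum_eq_smul (he : IsBBHT (m + 1) Set.univ (Simples (m + 1)) e) {k : ℕ}
    (hk : k ≤ m) : e (Simples (m + 1)) * hookSum (m + 1) m k =
      (-1 : ℂ) ^ k • (e (Simples (m + 1)) * of ℂ _ (cgen (m + 1) (m + 1) ^ k)) := by
  induction k with
  | zero => rw [hookSum_zero_right, pow_zero, pow_zero, one_smul, map_one]
  | succ k ih =>
    have h := apply_top_mul_hookSum he k.succ_pos hk
    rw [hookSum_succ_succ m.lt_succ_self, mul_add, ← mul_assoc, ih (by omega), smul_mul_assoc,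
      mul_assoc, ← map_mul, ← pow_succ] at h
    rw [eq_neg_of_add_eq_zero_left h, pow_succ (-1 : ℂ), mul_neg_one, neg_smul]

lemma apply_top_mul_prod (he : IsBBHT (m + 1) Set.univ (Simples (m + 1)) e) (ζ : ℂ) :
    e (Simples (m + 1)) *
        ((List.range m).map fun i => 1 - ζ • of ℂ _ (cgen (m + 1) (i + 1))).prod =
      e (Simples (m + 1)) *
        ∑ k ∈ range (m + 1), ζ ^ k • of ℂ _ (cgen (m + 1) (m + 1) ^ k) := by
  rw [prod_one_sub_smul_cgen ζ m.le_succ, mul_sum, mul_sum]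
  refine sum_congr rfl fun k hk => ?_
  rw [mul_smul_comm, apply_top_mul_hookSum_eq_smul he (Nat.le_of_lt_succ (mem_range.1 hk)),
    smul_smul, ← mul_pow, mul_neg_one, neg_neg, mul_smul_comm]

lemma isUnit_prod_one_sub_smul_cgen {ζ : ℂ} (hζ : IsPrimitiveRoot ζ (m + 1)) :
    IsUnit ((List.range m).map
      fun i => 1 - ζ • of ℂ (Perm (Fin (m + 1))) (cgen (m + 1) (i + 1))).prod := by
  refine List.prod_isUnit fun x hx => ?_
  obtain ⟨i, hi, rfl⟩ := List.mem_map.1 hx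
  have hi := List.mem_range.1 hi
  exact isUnit_one_sub_smul_of (cgen_pow_self (by omega))
    (hζ.pow_ne_one_of_pos_of_lt i.succ_ne_zero (by omega))

end Idempotent

/-- Lemma 5.5 (for `E_n`): with `c = c_n`, `ζ = e^{2πi/n}` and
`f⁺ = (1/n) ∑_{k=0}^{n-1} ζ^{−k} c^{−k}`, one has
`e_n f⁺ = (1/n) e_n (1 − ζc_1) ⋯ (1 − ζc_{n−1})`, and the idempotent `f⁺` acts
invertibly by right multiplication on `e_n`; in particular `e_n f⁺ ≠ 0` and
`e_n f⁺ ℂW = e_n ℂW`. -/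
theorem stmt14 (hn : 2 ≤ n)
    (e : Finset (Equiv.Perm (Fin n)) → MonoidAlgebra ℂ (Equiv.Perm (Fin n)))
    (he : IsBBHT n Set.univ (Simples n) e) :
    let en := e (Simples n)
    let c := cgen n n
    let ζ : ℂ := Complex.exp (2 * (Real.pi : ℂ) * Complex.I / (n : ℂ))
    let fplus : MonoidAlgebra ℂ (Equiv.Perm (Fin n)) :=
      ((n : ℂ))⁻¹ • ∑ k ∈ Finset.range n, (ζ⁻¹) ^ k • of ℂ (Equiv.Perm (Fin n)) ((c⁻¹) ^ k)
    (en * fplus = ((n : ℂ))⁻¹ •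
      (en * (((List.range (n - 1)).map
        (fun i => 1 - ζ • of ℂ (Equiv.Perm (Fin n)) (cgen n (i + 1)))).prod))) ∧
    (∃ y : MonoidAlgebra ℂ (Equiv.Perm (Fin n)), en * fplus * y = en) ∧
    en * fplus ≠ 0 ∧
    Set.range (fun x => en * fplus * x) = Set.range (fun x => en * x) := by
  obtain ⟨m, rfl⟩ : ∃ m, n = m + 1 := ⟨n - 1, by omega⟩
  intro en c ζ fplus
  have hζ : IsPrimitiveRoot ζ (m + 1) := Complex.isPrimitiveRoot_exp (m + 1) m.succ_ne_zero
  have hn0 : ((m + 1 : ℕ) : ℂ) ≠ 0 := Nat.cast_ne_zero.2 m.succ_ne_zero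
  have hprod : en * fplus = ((m + 1 : ℕ) : ℂ)⁻¹ • (en * (((List.range (m + 1 - 1)).map
      (fun i => 1 - ζ • of ℂ (Perm (Fin (m + 1))) (cgen (m + 1) (i + 1)))).prod)) := by
    rw [mul_smul_comm, Nat.add_sub_cancel, apply_top_mul_prod he,
      sum_inv_pow_smul_of (cgen_pow_self m.lt_succ_self) hζ.pow_eq_one]
  obtain ⟨u, hu⟩ := isUnit_prod_one_sub_smul_cgen hζ
  have hy : en * fplus * (((m + 1 : ℕ) : ℂ) • (↑u⁻¹ : MonoidAlgebra ℂ (Perm (Fin (m + 1))))) =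
      en := by
    rw [hprod, Nat.add_sub_cancel, ← hu, smul_mul_smul_comm, inv_mul_cancel₀ hn0, one_smul,
      Units.mul_inv_cancel_right]
  refine ⟨hprod, ⟨_, hy⟩, fun h0 => ?_, Set.Subset.antisymm ?_ ?_⟩
  · rw [h0, zero_mul] at hy
    exact apply_top_ne_zero he hy.symm
  · rintro _ ⟨x, rfl⟩
    exact ⟨fplus * x, (mul_assoc _ _ _).symm⟩
  · rintro _ ⟨x, rfl⟩
    exact ⟨_, (mul_assoc _ _ _).symm.trans (congrArg (· * x) hy)⟩

end DPRSym
end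
end

section
/- Every r ∈ N_λ centralizes the idempotents f⁺_λ and f⁻_λ in ℂS_n (r f^±_λ r⁻¹ = f^±_λ), and N_λ stabilizes the characters φ_λ and ε·φ_λ of Z_λ under conjugation: φ_λ(r z r⁻¹) = φ_λ(z) and ε(rzr⁻¹)φ_λ(rzr⁻¹) = ε(z)φ_λ(z) for all r ∈ N_λ and z ∈ Z_λ. Consequently φ_λ extends to a linear character of the centralizer Z_{S_n}(c_λ): there exists a group homomorphism φ̃_λ : Z_{S_n}(c_λ) → ℂˣ with φ̃_λ(z) = φ_λ(z) for all z ∈ Z_λ and φ̃_λ(r) = 1 for all r ∈ N_λ. -/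
open scoped Classical
open MonoidAlgebra Finset Equiv

noncomputable section

namespace DPRSym

variable (n : ℕ)

/-- Partial sums `τ_i = λ_1 + ⋯ + λ_i` of a partition. -/
def tau (lam : ℕ → ℕ) (i : ℕ) : ℕ := ∑ j ∈ Finset.range i, lam j

/-- `g_{λ_i} = s_{τ_i − 1} ⋯ s_{τ_{i−1}+2} s_{τ_{i−1}+1}`, a `λ_i`-cycle
(0-based block index `i`). -/
def gblock (lam : ℕ → ℕ) (i : ℕ) : Equiv.Perm (Fin n) :=
  (((List.range (lam i - 1)).reverse).map (fun j => sgen n (tau lam i + j + 1))).prod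

/-- `c_λ = g_{λ_1} g_{λ_2} ⋯ g_{λ_p}`, a permutation of cycle type `λ`. -/
def cpart (p : ℕ) (lam : ℕ → ℕ) : Equiv.Perm (Fin n) :=
  ((List.range p).map (gblock n lam)).prod

/-- `Z_λ = Z_{W_λ}(c_λ) = ⟨g_{λ_1}⟩ × ⋯ × ⟨g_{λ_p}⟩`. -/
def Zpart (p : ℕ) (lam : ℕ → ℕ) : Subgroup (Equiv.Perm (Fin n)) :=
  Subgroup.closure {x | ∃ i < p, x = gblock n lam i}

/-- The involution `r_i` interchanging the `i`-th and `(i+1)`-st blocks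
(when `λ_i = λ_{i+1}`). -/
def rgen (lam : ℕ → ℕ) (i : ℕ) : Equiv.Perm (Fin n) :=
  ((List.range (lam i)).map
    (fun j => fswap n (tau lam i + j) (tau lam (i + 1) + j))).prod

/-- `N_λ = ⟨r_i : λ_i = λ_{i+1}⟩`. -/
def Npart (p : ℕ) (lam : ℕ → ℕ) : Subgroup (Equiv.Perm (Fin n)) :=
  Subgroup.closure {x | ∃ i, i + 1 < p ∧ lam i = lam (i + 1) ∧ x = rgen n lam i}

/-- `f⁺_λ = f⁺_{λ_1} ⋯ f⁺_{λ_p}` where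
`f⁺_{λ_i} = (1/λ_i) ∑_{k=0}^{λ_i−1} e^{−2πik/λ_i} g_{λ_i}^{−k}`. -/
def fplusPart (p : ℕ) (lam : ℕ → ℕ) : MonoidAlgebra ℂ (Equiv.Perm (Fin n)) :=
  ((List.range p).map (fun i =>
    ((lam i : ℂ))⁻¹ • ∑ k ∈ Finset.range (lam i),
      Complex.exp (-(2 * (Real.pi : ℂ) * Complex.I) * (k : ℂ) / (lam i : ℂ)) •
        of ℂ (Equiv.Perm (Fin n)) ((gblock n lam i)⁻¹ ^ k))).prod

/-- `f⁻_λ = f⁻_{λ_1} ⋯ f⁻_{λ_p}` where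
`f⁻_{λ_i} = (1/λ_i) ∑_{k=0}^{λ_i−1} ε(g_{λ_i})^k e^{−2πik/λ_i} g_{λ_i}^{−k}`. -/
def fminusPart (p : ℕ) (lam : ℕ → ℕ) : MonoidAlgebra ℂ (Equiv.Perm (Fin n)) :=
  ((List.range p).map (fun i =>
    ((lam i : ℂ))⁻¹ • ∑ k ∈ Finset.range (lam i),
      ((((Equiv.Perm.sign (gblock n lam i) : ℤ) : ℂ)) ^ k *
        Complex.exp (-(2 * (Real.pi : ℂ) * Complex.I) * (k : ℂ) / (lam i : ℂ))) •
        of ℂ (Equiv.Perm (Fin n)) ((gblock n lam i)⁻¹ ^ k))).prod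

theorem sgen_val (i : ℕ) (hi : 0 < i) (hin : i < n) (x : Fin n) :
    (sgen n i x : ℕ) = if (x : ℕ) = i - 1 then i else if (x : ℕ) = i then i - 1 else x := by
  rw [sgen, dif_pos ⟨hi, hin⟩, Equiv.swap_apply_def]
  simp only [Fin.ext_iff]
  split_ifs <;> rfl

theorem fswap_val (a b : ℕ) (ha : a < n) (hb : b < n) (x : Fin n) :
    (fswap n a b x : ℕ) = if (x : ℕ) = a then b else if (x : ℕ) = b then a else x := by
  rw [fswap, dif_pos ⟨ha, hb⟩, Equiv.swap_apply_def]
  simp only [Fin.ext_iff]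
  split_ifs <;> rfl

theorem tau_succ (lam : ℕ → ℕ) (i : ℕ) : tau lam (i + 1) = tau lam i + lam i :=
  Finset.sum_range_succ _ _

theorem tau_mono (lam : ℕ → ℕ) : Monotone (tau lam) :=
  monotone_nat_of_le_succ fun i => by rw [tau_succ]; omega

theorem prod_sgen_val (t m : ℕ) (h : t + m < n) (x : Fin n) :
    ((((List.range m).reverse).map (fun j => sgen n (t + j + 1))).prod x : ℕ)
      = if (x : ℕ) = t then t + m
        else if t < (x : ℕ) ∧ (x : ℕ) ≤ t + m then (x : ℕ) - 1 else x := by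
  induction m with
  | zero =>
    simp only [List.range_zero, List.reverse_nil, List.map_nil, List.prod_nil, Perm.one_apply]
    split_ifs <;> omega
  | succ m ih =>
    rw [List.range_succ, List.reverse_append, List.reverse_singleton, List.singleton_append,
      List.map_cons, List.prod_cons, Perm.mul_apply,
      sgen_val n _ (by omega) (by omega), ih (by omega)]
    split_ifs <;> omega

theorem prod_fswap_val (t u m : ℕ) (htu : t + m ≤ u) (h : u + m ≤ n) (x : Fin n) :
    (((List.range m).map (fun j => fswap n (t + j) (u + j))).prod x : ℕ)
      = if t ≤ (x : ℕ) ∧ (x : ℕ) < t + m then x + u - t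
        else if u ≤ (x : ℕ) ∧ (x : ℕ) < u + m then x + t - u else x := by
  induction m generalizing x with
  | zero =>
    simp only [List.range_zero, List.map_nil, List.prod_nil, Perm.one_apply]
    split_ifs <;> omega
  | succ m ih =>
    rw [List.range_succ, List.map_append, List.prod_append, List.map_singleton,
      List.prod_singleton, Perm.mul_apply, ih (by omega) (by omega),
      fswap_val n _ _ (by omega) (by omega)]
    split_ifs <;> omega

section Blocks

variable {n} {p : ℕ} {lam : ℕ → ℕ}

theorem tau_le (hsum : ∑ j ∈ Finset.range p, lam j = n) {i : ℕ} (hi : i ≤ p) :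
    tau lam i ≤ n := by
  rw [← hsum]; exact tau_mono lam hi

theorem gblock_val (hpos : ∀ i < p, 0 < lam i) (hsum : ∑ j ∈ Finset.range p, lam j = n)
    {i : ℕ} (hi : i < p) (x : Fin n) :
    (gblock n lam i x : ℕ)
      = if (x : ℕ) = tau lam i then tau lam (i + 1) - 1
        else if tau lam i < (x : ℕ) ∧ (x : ℕ) < tau lam (i + 1) then (x : ℕ) - 1 else x := by
  have h1 := hpos i hi
  have h2 := tau_le hsum (Nat.succ_le_of_lt hi)
  have h3 := tau_succ lam i
  rw [Nat.succ_eq_add_one] at h2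
  rw [gblock, prod_sgen_val n _ _ (by omega)]
  split_ifs <;> omega

theorem rgen_val (hsum : ∑ j ∈ Finset.range p, lam j = n)
    {i : ℕ} (hi : i + 1 < p) (hl : lam i = lam (i + 1)) (x : Fin n) :
    (rgen n lam i x : ℕ)
      = if tau lam i ≤ (x : ℕ) ∧ (x : ℕ) < tau lam (i + 1) then x + lam i
        else if tau lam (i + 1) ≤ (x : ℕ) ∧ (x : ℕ) < tau lam (i + 2) then x - lam i else x := by
  have h2 := tau_le hsum (Nat.succ_le_of_lt hi)
  have h3 := tau_succ lam i
  have h4 := tau_succ lam (i + 1)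
  simp only [Nat.succ_eq_add_one, Nat.add_assoc, Nat.reduceAdd] at h2 h4
  rw [rgen, prod_fswap_val n _ _ _ (by omega) (by omega)]
  split_ifs <;> omega

theorem tau_succ_le_or (lam : ℕ → ℕ) {i j : ℕ} (h : i ≠ j) :
    tau lam (i + 1) ≤ tau lam j ∨ tau lam (j + 1) ≤ tau lam i := by
  rcases lt_or_gt_of_ne h with h | h
  · exact Or.inl (tau_mono lam h)
  · exact Or.inr (tau_mono lam h)

theorem gblock_commute (hpos : ∀ i < p, 0 < lam i) (hsum : ∑ j ∈ Finset.range p, lam j = n)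
    {i j : ℕ} (hi : i < p) (hj : j < p) : Commute (gblock n lam i) (gblock n lam j) := by
  rcases eq_or_ne i j with rfl | hij
  · exact Commute.refl _
  refine Equiv.ext fun x => Fin.ext ?_
  have h1 := hpos i hi
  have h2 := hpos j hj
  have h3 := tau_succ lam i
  have h4 := tau_succ lam j
  have h5 := tau_succ_le_or lam hij
  simp only [Perm.mul_apply, gblock_val hpos hsum hi, gblock_val hpos hsum hj]
  grind

theorem swap_lt {i k : ℕ} (hi : i + 1 < p) (hk : k < p) : Equiv.swap i (i + 1) k < p := by
  rw [Equiv.swap_apply_def]; split_ifs <;> omega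

theorem lam_swap {i : ℕ} (hl : lam i = lam (i + 1)) (k : ℕ) :
    lam (Equiv.swap i (i + 1) k) = lam k := by
  rw [Equiv.swap_apply_def]; split_ifs <;> simp_all

theorem rgen_semiconj (hpos : ∀ i < p, 0 < lam i) (hsum : ∑ j ∈ Finset.range p, lam j = n)
    {i k : ℕ} (hi : i + 1 < p) (hl : lam i = lam (i + 1)) (hk : k < p) :
    SemiconjBy (rgen n lam i) (gblock n lam k) (gblock n lam (Equiv.swap i (i + 1) k)) := by
  refine Equiv.ext fun x => Fin.ext ?_
  have h0 := swap_lt hi hk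
  have h1 := hpos i (by omega)
  have h2 := hpos k hk
  have h3 := tau_succ lam i
  have h4 := tau_succ lam (i + 1)
  have h5 := tau_succ lam k
  simp only [Perm.mul_apply, gblock_val hpos hsum hk, gblock_val hpos hsum h0,
    rgen_val hsum hi hl]
  rcases eq_or_ne k i with rfl | hki
  · rw [Equiv.swap_apply_left]; grind
  rcases eq_or_ne k (i + 1) with rfl | hki'
  · rw [Equiv.swap_apply_right]; grind
  rw [Equiv.swap_apply_of_ne_of_ne hki hki']
  have h6 := tau_succ_le_or lam hki
  have h7 := tau_succ_le_or lam hki'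
  grind

end Blocks

theorem semiconjBy_list_prod {M ι : Type*} [Monoid M] (u : M) (a b : ι → M) (l : List ι)
    (h : ∀ k ∈ l, SemiconjBy u (a k) (b k)) :
    SemiconjBy u (l.map a).prod (l.map b).prod := by
  induction l with
  | nil => simp
  | cons k l ih =>
    simp only [List.map_cons, List.prod_cons]
    exact (h k (by simp)).mul_right (ih fun k hk => h k (by simp [hk]))

/-- An element permuting the factors of a commuting product by an adjacent swap commutes with
the product. -/
theorem commute_prod_range {M : Type*} [Monoid M] {u : M} {a : ℕ → M} {p i : ℕ} (hi : i + 1 < p)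
    (hu : ∀ k < p, SemiconjBy u (a k) (a (Equiv.swap i (i + 1) k)))
    (hc : ∀ k < p, ∀ l < p, Commute (a k) (a l)) :
    Commute u ((List.range p).map a).prod := by
  have h := semiconjBy_list_prod u a (a ∘ Equiv.swap i (i + 1)) (List.range p)
    fun k hk => hu k (List.mem_range.1 hk)
  have hperm : ((List.range p).map (Equiv.swap i (i + 1))).Perm (List.range p) := by
    rw [List.perm_ext_iff_of_nodup (List.nodup_range.map (Equiv.injective _)) List.nodup_range]
    intro k
    simp only [List.mem_map, List.mem_range]
    refine ⟨?_, fun hk => ⟨Equiv.swap i (i + 1) k, swap_lt hi hk, Equiv.swap_apply_self _ _ _⟩⟩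
    rintro ⟨l, hl, rfl⟩
    exact swap_lt hi hl
  have heq := (hperm.map a).symm.prod_eq' (by
    rw [List.pairwise_map]
    refine List.Pairwise.imp_of_mem (R := fun _ _ => True) ?_ (List.pairwise_of_forall (by simp))
    intro k l hk hl _
    exact hc k (List.mem_range.1 hk) l (List.mem_range.1 hl))
  rw [List.map_map] at heq
  rw [← heq] at h
  exact h

section Blocks

variable {n} {p : ℕ} {lam : ℕ → ℕ}

theorem rgen_commute_cpart (hpos : ∀ i < p, 0 < lam i)
    (hsum : ∑ j ∈ Finset.range p, lam j = n)
    {i : ℕ} (hi : i + 1 < p) (hl : lam i = lam (i + 1)) :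
    Commute (rgen n lam i) (cpart n p lam) :=
  commute_prod_range hi (fun _ hk => rgen_semiconj hpos hsum hi hl hk)
    fun _ hk _ hl => gblock_commute hpos hsum hk hl

theorem gblock_commute_cpart (hpos : ∀ i < p, 0 < lam i)
    (hsum : ∑ j ∈ Finset.range p, lam j = n) {i : ℕ} (hi : i < p) :
    Commute (gblock n lam i) (cpart n p lam) := by
  refine Commute.list_prod_right _ _ fun x hx => ?_
  obtain ⟨k, hk, rfl⟩ := List.mem_map.1 hx
  exact gblock_commute hpos hsum hi (List.mem_range.1 hk)

theorem Zpart_le_centralizer (hpos : ∀ i < p, 0 < lam i)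
    (hsum : ∑ j ∈ Finset.range p, lam j = n) :
    Zpart n p lam ≤ Subgroup.centralizer {cpart n p lam} := by
  refine (Subgroup.closure_le _).2 ?_
  rintro _ ⟨i, hi, rfl⟩
  exact Subgroup.mem_centralizer_singleton_iff.2 (gblock_commute_cpart hpos hsum hi).eq

theorem Npart_le_centralizer (hpos : ∀ i < p, 0 < lam i)
    (hsum : ∑ j ∈ Finset.range p, lam j = n) :
    Npart n p lam ≤ Subgroup.centralizer {cpart n p lam} := by
  refine (Subgroup.closure_le _).2 ?_
  rintro _ ⟨i, hi, hl, rfl⟩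
  exact Subgroup.mem_centralizer_singleton_iff.2 (rgen_commute_cpart hpos hsum hi hl).eq

theorem Npart_le_normalizer (hpos : ∀ i < p, 0 < lam i)
    (hsum : ∑ j ∈ Finset.range p, lam j = n) {r z : Equiv.Perm (Fin n)}
    (hr : r ∈ Npart n p lam) (hz : z ∈ Zpart n p lam) : r * z * r⁻¹ ∈ Zpart n p lam := by
  have key : ∀ i, i + 1 < p → lam i = lam (i + 1) → ∀ z ∈ Zpart n p lam,
      rgen n lam i * z * (rgen n lam i)⁻¹ ∈ Zpart n p lam := by
    intro i hi hl
    have : Zpart n p lam ≤ (Zpart n p lam).comap (MulAut.conj (rgen n lam i)).toMonoidHom := by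
      refine (Subgroup.closure_le _).2 ?_
      rintro _ ⟨k, hk, rfl⟩
      have h := rgen_semiconj hpos hsum hi hl hk
      have : rgen n lam i * gblock n lam k * (rgen n lam i)⁻¹ ∈ Zpart n p lam := by
        rw [h.eq, mul_inv_cancel_right]
        exact Subgroup.subset_closure ⟨_, swap_lt hi hk, rfl⟩
      exact this
    exact this
  have hn : Npart n p lam ≤ Subgroup.normalizer (Zpart n p lam : Set (Equiv.Perm (Fin n))) := by
    refine (Subgroup.closure_le _).2 ?_
    rintro _ ⟨i, hi, hl, rfl⟩
    exact Subgroup.mem_normalizer_fintype (key i hi hl)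
  exact (Subgroup.mem_normalizer_iff.1 (hn hr) z).1 hz

/-- A product over the blocks of weighted sums of powers of the `g_{λ_k}⁻¹`, with weights
constant along blocks exchanged by `N_λ`, commutes with `N_λ`. -/
theorem Npart_commute_prod (hpos : ∀ i < p, 0 < lam i)
    (hsum : ∑ j ∈ Finset.range p, lam j = n) (w : ℕ → ℕ → ℂ)
    (hw : ∀ i, i + 1 < p → lam i = lam (i + 1) → ∀ k < p, w (Equiv.swap i (i + 1) k) = w k)
    {r : Equiv.Perm (Fin n)} (hr : r ∈ Npart n p lam) :
    Commute (of ℂ (Equiv.Perm (Fin n)) r)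
      ((List.range p).map (fun i => ((lam i : ℂ))⁻¹ • ∑ k ∈ Finset.range (lam i),
        w i k • of ℂ (Equiv.Perm (Fin n)) ((gblock n lam i)⁻¹ ^ k))).prod := by
  induction hr using Subgroup.closure_induction with
  | one => rw [map_one]; exact Commute.one_left _
  | mul x y _ _ hx hy => rw [map_mul]; exact hx.mul_left hy
  | inv x _ hx =>
    have h1 : of ℂ (Equiv.Perm (Fin n)) x * of ℂ _ x⁻¹ = 1 := by
      rw [← map_mul, mul_inv_cancel, map_one]
    have h2 : of ℂ (Equiv.Perm (Fin n)) x⁻¹ * of ℂ _ x = 1 := by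
      rw [← map_mul, inv_mul_cancel, map_one]
    exact Commute.units_inv_left (u := ⟨_, _, h1, h2⟩) hx
  | mem x hx =>
    obtain ⟨i, hi, hl, rfl⟩ := hx
    refine commute_prod_range hi (fun k hk => ?_) fun k hk l hl => ?_
    · rw [lam_swap hl, hw i hi hl k hk, SemiconjBy, mul_smul_comm, smul_mul_assoc, Finset.mul_sum,
        Finset.sum_mul]
      congr 1
      refine Finset.sum_congr rfl fun j _ => ?_
      rw [mul_smul_comm, smul_mul_assoc, ← map_mul, ← map_mul]
      congr 2
      exact ((rgen_semiconj hpos hsum hi hl hk).inv_right.pow_right j).eq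
    · refine ((Commute.sum_right _ _ _ fun j _ => ?_).smul_right _).smul_left _
      refine (Commute.smul_right ?_ _)
      refine (Commute.sum_left _ _ _ fun m _ => Commute.smul_left ?_ _)
      exact (((gblock_commute hpos hsum hk hl).inv_inv).pow_pow m j).map (of ℂ _)

theorem sign_gblock_swap (hpos : ∀ i < p, 0 < lam i)
    (hsum : ∑ j ∈ Finset.range p, lam j = n)
    {i k : ℕ} (hi : i + 1 < p) (hl : lam i = lam (i + 1)) (hk : k < p) :
    Perm.sign (gblock n lam (Equiv.swap i (i + 1) k)) = Perm.sign (gblock n lam k) := by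
  have h := congrArg Perm.sign (rgen_semiconj hpos hsum hi hl hk).eq
  rw [map_mul, map_mul, mul_comm] at h
  exact (mul_right_cancel h).symm

theorem prod_gblock_apply (hpos : ∀ i < p, 0 < lam i)
    (hsum : ∑ j ∈ Finset.range p, lam j = n) {m b : ℕ} (hm : m ≤ p) (hb : b < p) {x : Fin n}
    (h1 : tau lam b ≤ x) (h2 : (x : ℕ) < tau lam (b + 1)) :
    ((List.range m).map (gblock n lam)).prod x = if b < m then gblock n lam b x else x := by
  induction m generalizing x with
  | zero => simp
  | succ m ih =>
    rw [List.range_succ, List.map_append, List.prod_append, List.map_singleton,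
      List.prod_singleton, Perm.mul_apply]
    have hv := gblock_val hpos hsum (show m < p by omega) x
    have h3 := hpos b hb
    have h4 := tau_succ lam b
    have h5 := tau_succ lam m
    have h6 := hpos m (by omega)
    rcases eq_or_ne b m with rfl | hbm
    · rw [ih (by omega), if_neg (lt_irrefl _), if_pos (Nat.lt_succ_self _)]
      all_goals split_ifs at hv <;> omega
    · have h7 := tau_succ_le_or lam hbm
      have : gblock n lam m x = x := by
        refine Fin.ext ?_
        split_ifs at hv <;> omega
      rw [this, ih (by omega) h1 h2]
      congr 1
      exact propext (by omega)

theorem exists_block (hsum : ∑ j ∈ Finset.range p, lam j = n) (x : Fin n) :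
    ∃ b : Fin p, tau lam b ≤ x ∧ (x : ℕ) < tau lam (b + 1) := by
  have key : ∀ m, m ≤ p → (x : ℕ) < tau lam m →
      ∃ b < m, tau lam b ≤ x ∧ (x : ℕ) < tau lam (b + 1) := by
    intro m
    induction m with
    | zero => intro _ h; simp [tau] at h
    | succ m ih =>
      intro hm h
      by_cases hx : (x : ℕ) < tau lam m
      · obtain ⟨b, hb, h⟩ := ih (by omega) hx
        exact ⟨b, by omega, h⟩
      · exact ⟨m, by omega, by omega, h⟩
  obtain ⟨b, hb, h⟩ := key p le_rfl (by
    have := x.2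
    rw [tau, hsum]
    exact this)
  exact ⟨⟨b, hb⟩, h⟩

end Blocks

/-- The function `z ↦ ∏ᵢ h (z tᵢ)`, where the `tᵢ` are base points of the cycles of a
permutation `c` and `h` is multiplied along each cycle by a constant depending only on the cycle
length, is multiplicative on the centralizer of `c`. -/
theorem prod_base_mul {X ι : Type*} [Fintype X] [Fintype ι] [DecidableEq ι]
    (c : Equiv.Perm X) (b : X → ι)
    (t : ι → X) (hbt : ∀ i, b (t i) = i) (hbc : ∀ x, b (c x) = b x)
    (hct : ∀ x, ∃ k : ℕ, (c ^ k) x = t (b x)) (h : X → ℂ) (W : ℕ → ℂ) (ht : ∀ i, h (t i) = 1)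
    (hW : ∀ x, h (c x) = W (#{y | b y = b x}) * h x)
    {z w : Equiv.Perm X} (hz : Commute z c) (hw : Commute w c) :
    ∏ i, h ((z * w) (t i)) = (∏ i, h (z (t i))) * ∏ i, h (w (t i)) := by
  have hbck : ∀ (k : ℕ) x, b ((c ^ k) x) = b x := by
    intro k x
    induction k with
    | zero => rfl
    | succ k ih => rw [pow_succ', Perm.mul_apply, hbc, ih]
  have hWk : ∀ (k : ℕ) x, h ((c ^ k) x) = W (#{y | b y = b x}) ^ k * h x := by
    intro k x
    induction k with
    | zero => simp
    | succ k ih => rw [pow_succ', Perm.mul_apply, hW, ih, hbck, pow_succ', mul_assoc]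
  have hbz : ∀ z : Equiv.Perm X, Commute z c → ∀ x, b (z x) = b (z (t (b x))) := by
    intro z hz x
    obtain ⟨k, hk⟩ := hct x
    rw [← hk, ← Perm.mul_apply, (hz.pow_right k).eq, Perm.mul_apply, hbck]
  have hbz' : ∀ z : Equiv.Perm X, Commute z c → ∀ x y, b x = b y → b (z x) = b (z y) := by
    intro z hz x y hxy
    rw [hbz z hz x, hbz z hz y, hxy]
  have hcard : ∀ x, #{y | b y = b (z x)} = #{y | b y = b x} := by
    intro x
    refine (Finset.card_equiv z fun y => ?_).symm
    simp only [Finset.mem_filter, Finset.mem_univ, true_and]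
    refine ⟨hbz' z hz y x, fun hy => ?_⟩
    simpa using hbz' z⁻¹ hz.inv_left _ _ hy
  have hhz : ∀ x, h (z x) = h (z (t (b x))) * h x := by
    intro x
    obtain ⟨k, hk⟩ := hct x
    have h1 := hWk k x
    have h2 := hWk k (z x)
    rw [hk, ht] at h1
    rw [← Perm.mul_apply, ← (hz.pow_right k).eq, Perm.mul_apply, hk, hcard] at h2
    rw [h2, mul_right_comm, ← h1, one_mul]
  have hinj : Function.Injective fun i => b (w (t i)) := by
    intro i j hij
    have := hbz' w⁻¹ hw.inv_left _ _ hij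
    simpa [hbt] using this
  calc ∏ i, h ((z * w) (t i)) = ∏ i, h (z (t (b (w (t i))))) * h (w (t i)) :=
        Finset.prod_congr rfl fun i _ => hhz _
    _ = (∏ i, h (z (t (b (w (t i)))))) * ∏ i, h (w (t i)) := Finset.prod_mul_distrib
    _ = _ := by
        rw [Fintype.prod_bijective _ (Finite.injective_iff_bijective.1 hinj) _
          (fun i => h (z (t i))) fun _ => rfl]

section Blocks

variable {n} {p : ℕ} {lam : ℕ → ℕ}

theorem exp_shift (l m : ℕ) :
    Complex.exp (2 * (Real.pi : ℂ) * Complex.I * (m : ℂ) / (l : ℂ))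
      = Complex.exp (-(2 * (Real.pi : ℂ) * Complex.I) / (l : ℂ))
        * Complex.exp (2 * (Real.pi : ℂ) * Complex.I * ((m + 1 : ℕ) : ℂ) / (l : ℂ)) := by
  rw [← Complex.exp_add]
  congr 1
  push_cast
  ring

theorem exists_extension (hpos : ∀ i < p, 0 < lam i)
    (hsum : ∑ j ∈ Finset.range p, lam j = n) :
    ∃ φt : Equiv.Perm (Fin n) → ℂ,
      (∀ x ∈ Subgroup.centralizer {cpart n p lam},
        ∀ y ∈ Subgroup.centralizer {cpart n p lam}, φt (x * y) = φt x * φt y) ∧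
      φt 1 = 1 ∧ (∀ z, φt z ≠ 0) ∧
      (∀ i < p, φt (gblock n lam i)
        = Complex.exp (-(2 * (Real.pi : ℂ) * Complex.I) / (lam i : ℂ))) ∧
      (∀ i, i + 1 < p → lam i = lam (i + 1) → φt (rgen n lam i) = 1) := by
  choose b hb1 hb2 using exists_block (p := p) (lam := lam) (n := n) hsum
  have huniq : ∀ (x : Fin n) (i : Fin p), tau lam i ≤ x → (x : ℕ) < tau lam (i + 1) →
      b x = i := by
    intro x i h1 h2
    by_contra hne
    have := tau_succ_le_or lam (fun h => hne (Fin.ext h))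
    have := hb1 x
    have := hb2 x
    omega
  let t : Fin p → Fin n := fun i => ⟨tau lam i, by
    have h1 := tau_le hsum (Nat.succ_le_of_lt i.2)
    have h2 := hpos i i.2
    have h3 := tau_succ lam i
    rw [Nat.succ_eq_add_one] at h1
    omega⟩
  have htv : ∀ i, (t i : ℕ) = tau lam i := fun i => rfl
  have hbt : ∀ i, b (t i) = i := by
    intro i
    refine huniq _ _ le_rfl ?_
    have h2 := hpos i i.2
    rw [htv, tau_succ]
    omega
  have hcb : ∀ x, cpart n p lam x = gblock n lam (b x) x := by
    intro x
    rw [cpart, prod_gblock_apply hpos hsum le_rfl (b x).2 (hb1 x) (hb2 x), if_pos (b x).2]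
  have hcv : ∀ x, (cpart n p lam x : ℕ)
      = if (x : ℕ) = tau lam (b x) then tau lam (b x + 1) - 1 else x - 1 := by
    intro x
    rw [hcb, gblock_val hpos hsum (b x).2]
    have := hb1 x
    have := hb2 x
    split_ifs <;> omega
  have hbc : ∀ x, b (cpart n p lam x) = b x := by
    intro x
    have h1 := hb1 x
    have h2 := hb2 x
    have h3 := hcv x
    have h4 := hpos _ (b x).2
    have h5 := tau_succ lam (b x)
    apply huniq <;> split_ifs at h3 <;> omega
  have hct : ∀ (m : ℕ) (x : Fin n), (x : ℕ) = tau lam (b x) + m → (cpart n p lam ^ m) x = t (b x) := by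
    intro m
    induction m with
    | zero => intro x hx; exact Fin.ext hx
    | succ m ih =>
      intro x hx
      rw [pow_succ, Perm.mul_apply, ih, hbc]
      rw [hcv, hbc, if_neg (by omega)]
      omega
  have hcard : ∀ i : Fin p, #{y : Fin n | b y = i} = lam i := by
    intro i
    have h1 := tau_le hsum (Nat.succ_le_of_lt i.2)
    rw [Nat.succ_eq_add_one] at h1
    have h2 : lam i = #(Finset.Ico (tau lam i) (tau lam (i + 1))) := by
      rw [Nat.card_Ico, tau_succ]; omega
    rw [h2]
    refine Finset.card_bij (fun y _ => (y : ℕ)) ?_ (fun _ _ _ _ h => Fin.ext h) ?_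
    · intro y hy
      simp only [Finset.mem_filter, Finset.mem_univ, true_and] at hy
      subst hy
      exact Finset.mem_Ico.2 ⟨hb1 y, hb2 y⟩
    · intro y hy
      obtain ⟨h3, h4⟩ := Finset.mem_Ico.1 hy
      exact ⟨⟨y, by omega⟩, by simpa using huniq _ _ h3 h4, rfl⟩
  let h : Fin n → ℂ := fun x =>
    Complex.exp (2 * (Real.pi : ℂ) * Complex.I * (((x : ℕ) - tau lam (b x) : ℕ) : ℂ)
      / (lam (b x) : ℂ))
  let W : ℕ → ℂ := fun l => Complex.exp (-(2 * (Real.pi : ℂ) * Complex.I) / (l : ℂ))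
  have ht : ∀ i, h (t i) = 1 := by
    intro i
    simp [h, hbt, htv]
  have hhc : ∀ x, h (cpart n p lam x) = W (lam (b x)) * h x := by
    intro x
    simp only [h, W, hbc, hcv]
    have h1 := hb1 x
    have h2 := hb2 x
    have h4 := hpos _ (b x).2
    have h5 := tau_succ lam (b x)
    rw [show (if (x : ℕ) = tau lam (b x) then tau lam (b x + 1) - 1 else (x : ℕ) - 1)
      - tau lam (b x) = if (x : ℕ) = tau lam (b x) then lam (b x) - 1
        else (x : ℕ) - tau lam (b x) - 1 by split_ifs <;> omega]
    rw [exp_shift]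
    congr 1
    split_ifs with hx
    · have hne : (lam (b x) : ℂ) ≠ 0 := by exact_mod_cast h4.ne'
      rw [Nat.sub_add_cancel h4, mul_div_assoc, div_self hne, mul_one, Complex.exp_two_pi_mul_I,
        hx, Nat.sub_self]
      simp
    · rw [Nat.sub_add_cancel (by omega)]
  refine ⟨fun z => ∏ i, h (z (t i)), fun z hz w hw => ?_, ?_, ?_, ?_, ?_⟩
  · refine prod_base_mul (cpart n p lam) b t hbt hbc (fun x => ⟨_, hct (x - tau lam (b x)) x ?_⟩)
      h W ht (fun x => ?_) (Subgroup.mem_centralizer_singleton_iff.1 hz)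
      (Subgroup.mem_centralizer_singleton_iff.1 hw)
    · have := hb1 x
      omega
    · rw [hcard, hhc]
  · simp [ht]
  · intro z
    exact Finset.prod_ne_zero_iff.2 fun _ _ => Complex.exp_ne_zero _
  · intro i hi
    change ∏ k, h (gblock n lam i (t k)) = _
    rw [Finset.prod_eq_single (⟨i, hi⟩ : Fin p)]
    · have := hhc (t ⟨i, hi⟩)
      rwa [hcb, ht, mul_one, hbt] at this
    · intro k _ hk
      have h1 := gblock_val hpos hsum hi (t k)
      have h2 := tau_succ_le_or lam (fun h => hk (Fin.ext h) : (k : ℕ) ≠ i)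
      have h3 := tau_succ lam i
      have h4 := tau_succ lam k
      have h5 := hpos i hi
      have h6 := hpos k k.2
      rw [show gblock n lam i (t k) = t k from Fin.ext (by
        rw [htv] at h1 ⊢; split_ifs at h1 <;> omega), ht]
    · simp
  · intro i hi hl
    refine Finset.prod_eq_one fun k _ => ?_
    have : rgen n lam i (t k) = t ⟨Equiv.swap i (i + 1) k, swap_lt hi k.2⟩ := by
      refine Fin.ext ?_
      rw [rgen_val hsum hi hl, htv, htv]
      have h1 := tau_succ lam i
      have h2 := tau_succ lam (i + 1)
      have h3 := hpos i (by omega)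
      have h4 := hpos k k.2
      have h5 := tau_succ lam k
      rcases eq_or_ne (k : ℕ) i with hki | hki
      · simp only [hki, Equiv.swap_apply_left]; grind
      rcases eq_or_ne (k : ℕ) (i + 1) with hki' | hki'
      · simp only [hki', Equiv.swap_apply_right]; grind
      simp only [Equiv.swap_apply_of_ne_of_ne hki hki']
      have h6 := tau_succ_le_or lam hki
      have h7 := tau_succ_le_or lam hki'
      grind
    rw [this, ht]

end Blocks

/-- Functions multiplicative on a subgroup and taking the value `1` at `1` agree as soon as
they agree on generators. -/
theorem eq_on_closure {G : Type*} [Group G] {s : Set G} {f g : G → ℂ} (hf1 : f 1 = 1)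
    (hg1 : g 1 = 1)
    (hf : ∀ x ∈ Subgroup.closure s, ∀ y ∈ Subgroup.closure s, f (x * y) = f x * f y)
    (hg : ∀ x ∈ Subgroup.closure s, ∀ y ∈ Subgroup.closure s, g (x * y) = g x * g y)
    (h : ∀ x ∈ s, f x = g x) {x : G} (hx : x ∈ Subgroup.closure s) : f x = g x := by
  induction hx using Subgroup.closure_induction with
  | one => rw [hf1, hg1]
  | mul x y hx hy ihx ihy => rw [hf x hx y hy, hg x hx y hy, ihx, ihy]
  | inv x hx ih =>
    have h1 := hf x hx _ (inv_mem hx)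
    have h2 := hg x hx _ (inv_mem hx)
    rw [mul_inv_cancel, hf1, ih] at h1
    rw [mul_inv_cancel, hg1] at h2
    exact mul_left_cancel₀ (left_ne_zero_of_mul_eq_one h1.symm) (h1.symm.trans h2)
  | mem x hx => exact h x hx

/-- Lemma 6.1: the subgroup `N_λ` of `Z_{S_n}(c_λ)` centralizes the idempotents
`f⁺_λ` and `f⁻_λ`, and stabilizes the characters `φ_λ` and `ε φ_λ` of `Z_λ`
under conjugation; consequently `φ_λ` extends to a linear character `φ̃_λ` of
`Z_{S_n}(c_λ)` with `φ̃_λ|_{Z_λ} = φ_λ` and `φ̃_λ|_{N_λ} = 1`. -/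
theorem stmt16 (hn : 2 ≤ n) (p : ℕ) (hp : 0 < p) (lam : ℕ → ℕ)
    (hpos : ∀ i < p, 0 < lam i)
    (hmono : ∀ i j, i ≤ j → j < p → lam j ≤ lam i)
    (hsum : ∑ j ∈ Finset.range p, lam j = n)
    (φ : Equiv.Perm (Fin n) → ℂ)
    (hφ1 : φ 1 = 1)
    (hφmul : ∀ x ∈ Zpart n p lam, ∀ y ∈ Zpart n p lam, φ (x * y) = φ x * φ y)
    (hφg : ∀ i < p, φ (gblock n lam i)
      = Complex.exp (-(2 * (Real.pi : ℂ) * Complex.I) / (lam i : ℂ))) :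
    (∀ r ∈ Npart n p lam,
      of ℂ (Equiv.Perm (Fin n)) r * fplusPart n p lam
          = fplusPart n p lam * of ℂ (Equiv.Perm (Fin n)) r ∧
      of ℂ (Equiv.Perm (Fin n)) r * fminusPart n p lam
          = fminusPart n p lam * of ℂ (Equiv.Perm (Fin n)) r) ∧
    (∀ r ∈ Npart n p lam, ∀ z ∈ Zpart n p lam,
      r * z * r⁻¹ ∈ Zpart n p lam ∧
      φ (r * z * r⁻¹) = φ z ∧
      ((Equiv.Perm.sign (r * z * r⁻¹) : ℤ) : ℂ) * φ (r * z * r⁻¹)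
        = ((Equiv.Perm.sign z : ℤ) : ℂ) * φ z) ∧
    (∃ φt : Equiv.Perm (Fin n) → ℂ,
      (∀ x ∈ Subgroup.centralizer {cpart n p lam},
        ∀ y ∈ Subgroup.centralizer {cpart n p lam}, φt (x * y) = φt x * φt y) ∧
      φt 1 = 1 ∧
      (∀ z ∈ Subgroup.centralizer {cpart n p lam}, φt z ≠ 0) ∧
      (∀ z ∈ Zpart n p lam, φt z = φ z) ∧
      (∀ r ∈ Npart n p lam, φt r = 1)) := by
  obtain ⟨φt, hmul, hone, hne, hg, hr⟩ := exists_extension hpos hsum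
  have hZ := Zpart_le_centralizer hpos hsum
  have hN := Npart_le_centralizer hpos hsum
  have hφt : ∀ z ∈ Zpart n p lam, φt z = φ z := fun z hz =>
    eq_on_closure hone hφ1 (fun x hx y hy => hmul x (hZ hx) y (hZ hy)) hφmul
      (by rintro _ ⟨i, hi, rfl⟩; rw [hg i hi, hφg i hi]) hz
  have hφr : ∀ r ∈ Npart n p lam, φt r = 1 := fun r hr' =>
    eq_on_closure (g := fun _ => 1) hone rfl (fun x hx y hy => hmul x (hN hx) y (hN hy))
      (by simp) (by rintro _ ⟨i, hi, hl, rfl⟩; exact hr i hi hl) hr'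
  refine ⟨fun r hr' => ⟨?_, ?_⟩, fun r hr' z hz => ?_, φt, hmul, hone, fun z _ => hne z, hφt, hφr⟩
  · refine (Npart_commute_prod hpos hsum (fun i k =>
      Complex.exp (-(2 * (Real.pi : ℂ) * Complex.I) * (k : ℂ) / (lam i : ℂ))) ?_ hr').eq
    intro i _ hl k _
    simp only [lam_swap hl]
  · refine (Npart_commute_prod hpos hsum (fun i k =>
      (((Equiv.Perm.sign (gblock n lam i) : ℤ) : ℂ)) ^ k *
        Complex.exp (-(2 * (Real.pi : ℂ) * Complex.I) * (k : ℂ) / (lam i : ℂ))) ?_ hr').eq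
    intro i hi hl k hk
    simp only [lam_swap hl, sign_gblock_swap hpos hsum hi hl hk]
  · have hmem := Npart_le_normalizer hpos hsum hr' hz
    have hφ : φ (r * z * r⁻¹) = φ z := by
      rw [← hφt _ hmem, ← hφt z hz, hmul _ (mul_mem (hN hr') (hZ hz)) _ (inv_mem (hN hr')),
        hmul _ (hN hr') _ (hZ hz), hφr r hr', hφr _ (inv_mem hr'), one_mul, mul_one]
    refine ⟨hmem, hφ, ?_⟩
    rw [hφ, map_mul, map_mul, mul_right_comm, ← map_mul, mul_inv_cancel, map_one, one_mul]

end DPRSym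
end
end
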